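/- Let K=K(c) be an A_n-crystal. Every upper subcrystal of K contains exactly one principal vertex, and the map assigning to each upper subcrystal its unique principal vertex is a bijection from the set of upper subcrystals of K onto the principal lattice Pi; the same statement holds for the lower subcrystals of K. -/

import Mathlib

open Classical

noncomputable section

/-- Iterate a partial operator `k` times. -/
def optIter {V : Type} (f : V → Option V) : ℕ → V → Option V
  | 0, v => some v
  | k + 1, v => (f v).bind (optIter f k)

/-- A vertex type together with, for every natural number (color) `i`,
a partial operator whose graph is the set of `i`-edges. -/
structure PreGraph where
  V : Type
  F : ℕ → V → Option V

namespace PreGraph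

/-- Partial inverse operator of color `i`. -/
def Finv (K : PreGraph) (i : ℕ) (v : K.V) : Option K.V :=
  if h : ∃ u, K.F i u = some v then some h.choose else none

/-- Number of edges of the maximal `i`-colored path beginning at `v`. -/
def h (K : PreGraph) (i : ℕ) (v : K.V) : ℕ :=
  sSup {k | (optIter (K.F i) k v).isSome = true}

/-- Number of edges of the maximal `i`-colored path ending at `v`. -/
def t (K : PreGraph) (i : ℕ) (v : K.V) : ℕ :=
  sSup {k | ∃ u, optIter (K.F i) k u = some v}

/-- One (undirected) step along an edge of any color. -/
def Step (K : PreGraph) (u v : K.V) : Prop :=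
  ∃ i, K.F i u = some v ∨ K.F i v = some u

/-- Weak connectivity. -/
def Connected (K : PreGraph) : Prop :=
  ∀ u v : K.V, Relation.ReflTransGen K.Step u v

/-- All edges have colors in `C`. -/
def ColorsIn (K : PreGraph) (C : Set ℕ) : Prop :=
  ∀ i ∉ C, ∀ v, K.F i v = none

end PreGraph

/-- `s` has no incoming edges. -/
def IsSource (K : PreGraph) (s : K.V) : Prop := ∀ i u, K.F i u ≠ some s

/-- `tv` has no outgoing edges. -/
def IsSink (K : PreGraph) (tv : K.V) : Prop := ∀ i, K.F i tv = none

/-- `K` is a (finite) colored graph with colors in `C` satisfying axiom (A1):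
every connected monochromatic subgraph is a finite directed path. -/
def IsColored (K : PreGraph) (C : Set ℕ) : Prop :=
  Finite K.V ∧ K.ColorsIn C ∧
  (∀ (i : ℕ) (u u' v : K.V), K.F i u = some v → K.F i u' = some v → u = u') ∧
  (∀ (i : ℕ) (v : K.V) (k : ℕ), 0 < k → optIter (K.F i) k v ≠ some v)

/-- `|i - j| = 1`. -/
def Neighb (i j : ℕ) : Prop := i + 1 = j ∨ j + 1 = i

/-- `|i - j| ≥ 2`. -/
def Far (i j : ℕ) : Prop := i + 2 ≤ j ∨ j + 2 ≤ i

instance (i j : ℕ) : Decidable (Neighb i j) := by unfold Neighb; infer_instance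
instance (i j : ℕ) : Decidable (Far i j) := by unfold Far; infer_instance

/-- Axiom (A2) for the ordered pair of distinct colors `(i, j)`. -/
def A2at (K : PreGraph) (i j : ℕ) : Prop :=
  (∀ u v, K.F i u = some v →
    K.t j v ≤ K.t j u ∧ K.h j u ≤ K.h j v ∧
    ((K.h j u : ℤ) - (K.t j u : ℤ)) - ((K.h j v : ℤ) - (K.t j v : ℤ)) =
      (if Neighb i j then (-1 : ℤ) else 0)) ∧
  (∀ u v w, K.F i u = some v → K.F i v = some w →
    2 * K.h j v ≤ K.h j u + K.h j w)

/-- Axiom (A3) for neighboring colors `i, j`. -/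
def A3at (K : PreGraph) (i j : ℕ) : Prop :=
  (∀ u v v', K.F i u = some v → K.F j u = some v' →
    K.h j v = K.h j u →
    ((K.h i v' : ℤ) - (K.h i u : ℤ) = 1 ∧ ∃ w, K.F j v = some w ∧ K.F i v' = some w)) ∧
  (∀ u u' v, K.F i u = some v → K.F j u' = some v →
    (K.h j v : ℤ) - (K.h j u : ℤ) = 1 →
    (K.h i v = K.h i u' ∧ ∃ w, K.F j w = some u ∧ K.F i w = some u'))

/-- Axiom (A4) (Verma relations) for neighboring colors `i, j`. -/
def A4at (K : PreGraph) (i j : ℕ) : Prop :=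
  (∀ u v v', K.F i u = some v → K.F j u = some v' →
    (K.h j v : ℤ) - (K.h j u : ℤ) = 1 → (K.h i v' : ℤ) - (K.h i u : ℤ) = 1 →
    ∃ w, (((K.F i u).bind (K.F j)).bind (K.F j)).bind (K.F i) = some w ∧
         (((K.F j u).bind (K.F i)).bind (K.F i)).bind (K.F j) = some w) ∧
  (∀ u u' v, K.F i u = some v → K.F j u' = some v →
    K.h j v = K.h j u → K.h i v = K.h i u' →
    ∃ w, (((K.Finv i v).bind (K.Finv j)).bind (K.Finv j)).bind (K.Finv i) = some w ∧
         (((K.Finv j v).bind (K.Finv i)).bind (K.Finv i)).bind (K.Finv j) = some w)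

/-- Axiom (A5) for colors `i, j` at distance at least 2. -/
def A5at (K : PreGraph) (i j : ℕ) : Prop :=
  ∀ Fi ∈ ({K.F i, K.Finv i} : Set (K.V → Option K.V)),
  ∀ Fj ∈ ({K.F j, K.Finv j} : Set (K.V → Option K.V)),
  ∀ v, (Fi v).isSome → (Fj v).isSome →
    ∃ w, (Fi v).bind Fj = some w ∧ (Fj v).bind Fi = some w

/-- `K` is a regular crystal of type A on the color set `C`
(an `A_{|C|}`-crystal when `C` is an integer interval). -/
def IsCrystalOn (K : PreGraph) (C : Set ℕ) : Prop :=
  IsColored K C ∧ K.Connected ∧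
  (∀ i ∈ C, ∀ j ∈ C, i ≠ j → A2at K i j) ∧
  (∀ i ∈ C, ∀ j ∈ C, Neighb i j → A3at K i j ∧ A4at K i j) ∧
  (∀ i ∈ C, ∀ j ∈ C, Far i j → A5at K i j)

/-- `K` is an `A_n`-crystal (colors `1, …, n`). -/
def IsACrystal (n : ℕ) (K : PreGraph) : Prop := IsCrystalOn K (Set.Icc 1 n)

/-- Apply a list of operators, head first. -/
def applyStr (K : PreGraph) : List ℕ → K.V → Option K.V
  | [], v => some v
  | i :: L, v => (K.F i v).bind (applyStr K L)

/-- The string `w_{m,k,j} = F_{o+j} F_{o+j+1} ⋯ F_{o+j+k-1}` (rightmost applied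
first, i.e. head of the list applied first) for a crystal with colors `o+1, …, o+m`. -/
def wStr (o k j : ℕ) : List ℕ := (List.range k).map (fun m => o + j + k - 1 - m)

/-- The string `S_{m,k} = w_{m,k,m-k+1} ⋯ w_{m,k,2} w_{m,k,1}` for a crystal with
colors `o+1, …, o+m`. -/
def SStr (o m k : ℕ) : List ℕ :=
  (List.range (m - k + 1)).flatMap fun jm => wStr o k (jm + 1)

/-- The string `S_{m,m}^{a_{o+m}} ⋯ S_{m,1}^{a_{o+1}}` for a crystal with colors
`o+1, …, o+m`, defining the principal vertex with coordinates `a`. -/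
def prinStr (o m : ℕ) (a : ℕ → ℕ) : List ℕ :=
  (List.range m).flatMap fun km => (List.replicate (a (o + km + 1)) (SStr o m (km + 1))).flatten

def prinOpt (K : PreGraph) (o m : ℕ) (s : K.V) (a : ℕ → ℕ) : Option K.V :=
  applyStr K (prinStr o m a) s

/-- `p` is the principal vertex with coordinates `a` of the crystal `K` with colors
`o+1, …, o+m` and source `s`. -/
def IsPrin (K : PreGraph) (o m : ℕ) (s : K.V) (a : ℕ → ℕ) (p : K.V) : Prop :=
  prinOpt K o m s a = some p

/-- The principal lattice of an `A_n`-crystal with source `s` and parameter `c`. -/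
def PrinLat (K : PreGraph) (n : ℕ) (s : K.V) (c : ℕ → ℕ) : Set K.V :=
  {p | ∃ a : ℕ → ℕ, (∀ i, 1 ≤ i → i ≤ n → a i ≤ c i) ∧ IsPrin K 0 n s a p}

/-- One undirected step along an edge with color in `I`. -/
def stepOn (K : PreGraph) (I : Set ℕ) (u v : K.V) : Prop :=
  ∃ i ∈ I, K.F i u = some v ∨ K.F i v = some u

/-- `u` lies in the same `I`-colored component as `v`. -/
def inComp (K : PreGraph) (I : Set ℕ) (v u : K.V) : Prop :=
  Relation.ReflTransGen (stepOn K I) v u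

/-- The subcrystal of `K` with color set `I` containing `v` (the maximal connected
subgraph through `v` using only colors in `I`). -/
def PreGraph.sub (K : PreGraph) (I : Set ℕ) (v : K.V) : PreGraph where
  V := {u : K.V // inComp K I v u}
  F := fun i u =>
    if hi : i ∈ I then
      (K.F i u.1).pbind fun w hw =>
        some ⟨w, Relation.ReflTransGen.tail u.2 ⟨i, hi, Or.inl (Option.mem_def.mp hw)⟩⟩
    else none

/-- Directed reachability. -/
def dirReach (K : PreGraph) (u v : K.V) : Prop :=
  Relation.ReflTransGen (fun a b => ∃ i, K.F i a = some b) u v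

/-- The interval of `K` from `p` to `q`: the subgraph formed by all vertices and
edges lying on directed paths from `p` to `q`. -/
def PreGraph.interval (K : PreGraph) (p q : K.V) : PreGraph where
  V := {w : K.V // dirReach K p w ∧ dirReach K w q}
  F := fun i u =>
    (K.F i u.1).pbind fun w _ =>
      if hw : dirReach K p w ∧ dirReach K w q then some ⟨w, hw⟩ else none

/-- The symmetric extract: restriction to self-complementary vertices,
with `ibar`-edges given by `chain i`. -/
def extract (K : PreGraph) (chain : ℕ → K.V → Option K.V) (σ : K.V → K.V) : PreGraph where
  V := {v : K.V // σ v = v}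
  F := fun i u =>
    (chain i u.1).pbind fun w _ => if hw : σ w = w then some ⟨w, hw⟩ else none

/-- The operator chain for the color `ibar` of the symmetric extract of a
symmetric `A_{2n-1}`-crystal. -/
def chainB (K : PreGraph) (n : ℕ) (i : ℕ) (u : K.V) : Option K.V :=
  if 1 ≤ i ∧ i ≤ n then
    (if i = n then K.F n u else (K.F i u).bind (K.F (2 * n - i)))
  else none

/-- The operator chain for the color `ibar` of the symmetric extract of a
symmetric `A_{2n}`-crystal. -/
def chainC (K : PreGraph) (n : ℕ) (i : ℕ) (u : K.V) : Option K.V :=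
  if 1 ≤ i ∧ i ≤ n then
    (if i = n then (((K.F n u).bind (K.F (n + 1))).bind (K.F (n + 1))).bind (K.F n)
     else (K.F i u).bind (K.F (2 * n + 1 - i)))
  else none

/-- Symmetric extract from a symmetric `A_{2n-1}`-crystal. -/
def extractB (K : PreGraph) (n : ℕ) (σ : K.V → K.V) : PreGraph := extract K (chainB K n) σ

/-- Symmetric extract from a symmetric `A_{2n}`-crystal. -/
def extractC (K : PreGraph) (n : ℕ) (σ : K.V → K.V) : PreGraph := extract K (chainC K n) σ

/-- Admissibility of a six-tuple `(x', y, x''; y', x, y'')` in the worm model. -/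
def WormOK (g1 g2 : ℕ) : ℤ × ℤ × ℤ × ℤ × ℤ × ℤ → Prop
  | (x', y, x'', y', x, y'') =>
    (0 ≤ x' ∧ x' ≤ 2 * (g1 : ℤ)) ∧ (0 ≤ x'' ∧ x'' ≤ 2 * (g1 : ℤ)) ∧
    (0 ≤ x ∧ x ≤ 2 * (g1 : ℤ)) ∧
    (0 ≤ y' ∧ y' ≤ (g2 : ℤ)) ∧ (0 ≤ y'' ∧ y'' ≤ (g2 : ℤ)) ∧ (0 ≤ y ∧ y ≤ (g2 : ℤ)) ∧
    (2 ∣ x') ∧ (2 ∣ x'') ∧ (y' ≤ y ∧ y ≤ y'') ∧ (x' ≤ x ∧ x ≤ x'') ∧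
    (y' < y → x' = x) ∧ (y < y'' → x = x'')

/-- The candidate image of a worm under the operator `1tilde`. -/
def worm1 : ℤ × ℤ × ℤ × ℤ × ℤ × ℤ → ℤ × ℤ × ℤ × ℤ × ℤ × ℤ
  | (x', y, x'', y', x, y'') =>
    if 2 * x > x' + x'' then (x' + 2, y, x'', y', x, y'')
    else if x = x' ∧ x' = x'' ∧ y < y'' then (x', y + 1, x'', y', x, y'')
    else (x', y, x'' + 2, y', x, y'')

/-- The candidate image of a worm under the operator `2tilde`. -/
def worm2 : ℤ × ℤ × ℤ × ℤ × ℤ × ℤ → ℤ × ℤ × ℤ × ℤ × ℤ × ℤ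
  | (x', y, x'', y', x, y'') =>
    if 2 * y > y' + y'' then (x', y, x'', y' + 1, x, y'')
    else if y' = y ∧ y = y'' ∧ x < x'' then (x', y, x'', y', x + 1, y'')
    else (x', y, x'', y', x, y'' + 1)

/-- The worm graph `W(g1, g2)`, with colors `1 = 1tilde` and `2 = 2tilde`. -/
def WormGraph (g1 g2 : ℕ) : PreGraph where
  V := {w : ℤ × ℤ × ℤ × ℤ × ℤ × ℤ // WormOK g1 g2 w}
  F := fun i u =>
    if i = 1 then
      (if h1 : WormOK g1 g2 (worm1 u.1) then some ⟨worm1 u.1, h1⟩ else none)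
    else if i = 2 then
      (if h2 : WormOK g1 g2 (worm2 u.1) then some ⟨worm2 u.1, h2⟩ else none)
    else none

/-- Isomorphism of colored graphs, renaming colors via `φ`. -/
def IsoVia (K L : PreGraph) (φ : ℕ → ℕ) : Prop :=
  ∃ e : K.V ≃ L.V, ∀ i u v, K.F i u = some v ↔ L.F (φ i) (e u) = some (e v)

/-- The Cartesian product of an `i`-path of length `p` and a `j`-path of length `q`. -/
def boxGraph (i j p q : ℕ) : PreGraph where
  V := Fin (p + 1) × Fin (q + 1)
  F := fun s u =>
    if s = i then
      (if h : (u.1 : ℕ) < p then some (⟨(u.1 : ℕ) + 1, by omega⟩, u.2) else none)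
    else if s = j then
      (if h : (u.2 : ℕ) < q then some (u.1, ⟨(u.2 : ℕ) + 1, by omega⟩) else none)
    else none

/-- `B_n`-crystal: components with colors `n-1, n` are worm graphs,
with color `n-1` corresponding to `1tilde` and `n` to `2tilde`. -/
def IsBCrystal (n : ℕ) (B : PreGraph) : Prop :=
  IsColored B (Set.Icc 1 n) ∧ B.Connected ∧
  (∀ i ∈ Set.Icc 1 n, ∀ j ∈ Set.Icc 1 n, Far i j → A5at B i j) ∧
  (∀ i j, 1 ≤ i → i < n → 1 ≤ j → j < n → Neighb i j →
    ∀ v : B.V, IsCrystalOn (B.sub {i, j} v) {i, j}) ∧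
  (∀ v : B.V, ∃ g1 g2 : ℕ,
    IsoVia (B.sub ({n - 1, n} : Set ℕ) v) (WormGraph g1 g2)
      (fun x => if x = n - 1 then 1 else if x = n then 2 else 0))

/-- `C_n`-crystal: components with colors `n-1, n` are worm graphs,
with color `n-1` corresponding to `2tilde` and `n` to `1tilde`. -/
def IsCCrystal (n : ℕ) (B : PreGraph) : Prop :=
  IsColored B (Set.Icc 1 n) ∧ B.Connected ∧
  (∀ i ∈ Set.Icc 1 n, ∀ j ∈ Set.Icc 1 n, Far i j → A5at B i j) ∧
  (∀ i j, 1 ≤ i → i < n → 1 ≤ j → j < n → Neighb i j →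
    ∀ v : B.V, IsCrystalOn (B.sub {i, j} v) {i, j}) ∧
  (∀ v : B.V, ∃ g1 g2 : ℕ,
    IsoVia (B.sub ({n - 1, n} : Set ℕ) v) (WormGraph g1 g2)
      (fun x => if x = n - 1 then 2 else if x = n then 1 else 0))

/-! ### The crossing model -/

/-- `(k, i, j)` is a node `v_i^k(j)` of the supporting graph `G` for rank `n`. -/
def isNode (n k i j : ℕ) : Prop :=
  1 ≤ j ∧ j ≤ i ∧ i ≤ n ∧ i - j + 1 ≤ k ∧ k ≤ n - j + 1

instance (n k i j : ℕ) : Decidable (isNode n k i j) := by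
  unfold isNode; infer_instance

/-- Extension of a function on the nodes of `G` to the extended supporting graph:
extra nodes from which `G^k` is reachable get value `c k`, the others get `0`. -/
def fext (n : ℕ) (c : ℕ → ℕ) (f : ℕ × ℕ × ℕ → ℤ) (k i j : ℕ) : ℤ :=
  if isNode n k i j then f (k, i, j)
  else if j ≤ n - k + 1 then (c k : ℤ) else 0

/-- The slack at the node `v_i^k(j)`. -/
def epsN (n : ℕ) (c : ℕ → ℕ) (f : ℕ × ℕ × ℕ → ℤ) (k i j : ℕ) : ℤ :=
  (fext n c f k (i - 1) (j - 1) - fext n c f k i j) -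
    (fext n c f k i (j - 1) - fext n c f k (i + 1) j)

/-- The total slack at the multinode `V_i(j)`. -/
def epsTot (n : ℕ) (c : ℕ → ℕ) (f : ℕ × ℕ × ℕ → ℤ) (i j : ℕ) : ℤ :=
  ∑ k ∈ Finset.Icc (i - j + 1) (n - j + 1), epsN n c f k i j

/-- The reduced slack at the multinode `V_i(j)`. -/
def teps (n : ℕ) (c : ℕ → ℕ) (f : ℕ × ℕ × ℕ → ℤ) (i j : ℕ) : ℤ :=
  if hj : (Finset.Icc 1 j).Nonempty then
    max 0 ((Finset.Icc 1 j).inf' hj fun p => ∑ q ∈ Finset.Icc p j, epsTot n c f i q)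
  else 0

/-- `k0` satisfies the switch condition in the multinode `V_i(j)`. -/
def switchCond (n : ℕ) (f : ℕ × ℕ × ℕ → ℤ) (i j k0 : ℕ) : Prop :=
  i - j + 1 ≤ k0 ∧ k0 ≤ n - j + 1 ∧
  (∀ k, i - j + 1 ≤ k → k < k0 → isNode n k (i + 1) (j + 1) →
    f (k, i, j) = f (k, i + 1, j + 1)) ∧
  (∀ k, k0 < k → k ≤ n - j + 1 → isNode n k (i + 1) j →
    f (k, i + 1, j) = f (k, i, j))

/-- The switch-node (first node with the switch property) of the multinode `V_i(j)`. -/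
def switchNode (n : ℕ) (f : ℕ × ℕ × ℕ → ℤ) (i j : ℕ) : ℕ :=
  sInf {k0 | switchCond n f i j k0}

/-- Feasible functions of the crossing model (normalized to vanish off the nodes). -/
def Feasible (n : ℕ) (c : ℕ → ℕ) (f : ℕ × ℕ × ℕ → ℤ) : Prop :=
  (∀ k i j, ¬ isNode n k i j → f (k, i, j) = 0) ∧
  (∀ k i j, isNode n k i j → isNode n k (i - 1) j → f (k, i - 1, j) ≤ f (k, i, j)) ∧
  (∀ k i j, isNode n k i j → isNode n k (i + 1) (j + 1) → f (k, i + 1, j + 1) ≤ f (k, i, j)) ∧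
  (∀ k i j, isNode n k i j → 0 ≤ f (k, i, j) ∧ f (k, i, j) ≤ (c k : ℤ)) ∧
  (∀ i j, 1 ≤ j → j ≤ i → i ≤ n → ∃ k0, switchCond n f i j k0)

/-- Increase `f` by one at the node `(k, i, j)`. -/
def bump (f : ℕ × ℕ × ℕ → ℤ) (k i j : ℕ) : ℕ × ℕ × ℕ → ℤ :=
  fun x => if x = (k, i, j) then f x + 1 else f x

/-- The crossing-model graph `Kscr(c)`: vertices are the feasible functions, and
the move `φ_i` increases `f` by one at the switch-node of the active multinode. -/
def Kscr (n : ℕ) (c : ℕ → ℕ) : PreGraph where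
  V := {f : ℕ × ℕ × ℕ → ℤ // Feasible n c f}
  F := fun i f =>
    if 1 ≤ i ∧ i ≤ n ∧ ∃ j, 1 ≤ j ∧ j ≤ i ∧ 0 < teps n c f.1 i j then
      (let j := sSup {j | 1 ≤ j ∧ j ≤ i ∧ 0 < teps n c f.1 i j}
       let g := bump f.1 (switchNode n f.1 i j) i j
       if hg : Feasible n c g then some ⟨g, hg⟩ else none)
    else none

/-- The function `f_{a,D}` of the crossing model. -/
def faD (n : ℕ) (a : ℕ → ℕ) (D : ℕ → ℤ) : ℕ × ℕ × ℕ → ℤ := fun x =>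
  if isNode n x.1 x.2.1 x.2.2 then
    (if x.2.1 - x.2.2 + 1 = x.1 then (a x.1 : ℤ) else (a x.1 : ℤ) + min (D (x.1 - 1)) 0) +
    (if x.2.2 ≤ n - x.1 then max (D x.1) 0 else 0)
  else 0

/-! ### Descriptions of self-complementary vertices -/

/-- `(a1, a2, δ, l)` is the description of a self-complementary vertex `v` of a
symmetric `A_3`-crystal `K` with source `s` and parameter `c`. -/
def IsDescB (K : PreGraph) (s : K.V) (c : ℕ → ℕ) (v : K.V) (q : ℕ × ℕ × ℤ × ℕ) : Prop :=
  q.2.2.2 = K.t 2 v ∧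
  ∃ (a : ℕ → ℕ) (pa : K.V),
    a 1 = q.1 ∧ a 2 = q.2.1 ∧ a 3 = ((q.1 : ℤ) + max q.2.2.1 0).toNat ∧
    (∀ i, 1 ≤ i → i ≤ 3 → a i ≤ c i) ∧
    IsPrin K 0 3 s a pa ∧ inComp K (Set.Icc 1 2) pa v ∧
    0 ≤ (q.2.1 : ℤ) + q.2.2.1 ∧ 0 ≤ (a 3 : ℤ) - q.2.2.1 ∧
    ∃ s' : (K.sub (Set.Icc 1 2) pa).V, IsSource (K.sub (Set.Icc 1 2) pa) s' ∧
    ∃ z : (K.sub (Set.Icc 1 2) pa).V,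
      IsPrin (K.sub (Set.Icc 1 2) pa) 0 2 s'
        (fun i => if i = 1 then ((q.2.1 : ℤ) + q.2.2.1).toNat else ((a 3 : ℤ) - q.2.2.1).toNat) z ∧
      inComp K ({2} : Set ℕ) z.1 v

/-- The polytope of descriptions for a symmetric `A_3`-crystal with parameter `(c1, c2, c1)`. -/
def QuadB (c1 c2 : ℕ) : Set (ℕ × ℕ × ℤ × ℕ) :=
  {q | q.1 ≤ c1 ∧ q.2.1 ≤ c2 ∧ -(q.2.1 : ℤ) ≤ q.2.2.1 ∧ (q.2.1 : ℤ) - (c2 : ℤ) ≤ q.2.2.1 ∧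
       q.2.2.1 ≤ (c1 : ℤ) - (q.1 : ℤ) ∧ (q.2.2.2 : ℤ) ≤ (c2 : ℤ) + 2 * q.2.2.1}

/-- The worm associated to the description `(a1, a2, δ, l)`. -/
def wtupleB (a1 a2 : ℕ) (δ : ℤ) (l : ℕ) : ℤ × ℤ × ℤ × ℤ × ℤ × ℤ :=
  let a3 : ℤ := (a1 : ℤ) + max δ 0
  let tr : ℤ × ℤ × ℤ :=
    if 0 ≤ δ then
      if (l : ℤ) ≤ (a2 : ℤ) then ((l : ℤ), 2 * (a1 : ℤ), (a2 : ℤ))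
      else if (l : ℤ) ≤ (a2 : ℤ) + 2 * δ then
        ((a2 : ℤ), 2 * (a1 : ℤ) + (l : ℤ) - (a2 : ℤ), (a2 : ℤ))
      else ((a2 : ℤ), 2 * a3, (l : ℤ) - 2 * δ)
    else
      if (l : ℤ) ≤ (a2 : ℤ) + δ then ((l : ℤ), 2 * (a1 : ℤ), (a2 : ℤ) - δ)
      else ((a2 : ℤ) + δ, 2 * (a1 : ℤ), (l : ℤ) - 2 * δ)
  (2 * (a1 : ℤ), (a2 : ℤ), 2 * a3, tr.1, tr.2.1, tr.2.2)

def wtQ (q : ℕ × ℕ × ℤ × ℕ) : ℤ × ℤ × ℤ × ℤ × ℤ × ℤ :=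
  wtupleB q.1 q.2.1 q.2.2.1 q.2.2.2

/-- The string `(F_2 F_3)^r (F_3 F_2)^r` (rightmost applied first). -/
def diagStr (r : ℕ) : List ℕ :=
  (List.replicate r ([2, 3] : List ℕ)).flatten ++ (List.replicate r ([3, 2] : List ℕ)).flatten

/-- `(a1, a2, δ, ρ)` is the description of a self-complementary vertex `v` of a
symmetric `A_4`-crystal `K` with source `s` and parameter `c`. -/
def IsDescC (K : PreGraph) (s : K.V) (c : ℕ → ℕ) (v : K.V) (q : ℕ × ℕ × ℤ × ℕ) : Prop :=
  ∃ (a : ℕ → ℕ) (pa : K.V),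
    a 1 = q.1 ∧ a 2 = q.2.1 ∧ a 3 = ((q.2.1 : ℤ) + min q.2.2.1 0).toNat ∧
    a 4 = ((q.1 : ℤ) + max q.2.2.1 0).toNat ∧
    (∀ i, 1 ≤ i → i ≤ 4 → a i ≤ c i) ∧
    IsPrin K 0 4 s a pa ∧ inComp K (Set.Icc 1 3) pa v ∧
    0 ≤ (q.2.1 : ℤ) + q.2.2.1 ∧ 0 ≤ (a 4 : ℤ) - q.2.2.1 ∧
    (∃ s' : (K.sub (Set.Icc 1 3) pa).V, IsSource (K.sub (Set.Icc 1 3) pa) s' ∧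
     ∃ z : (K.sub (Set.Icc 1 3) pa).V,
       IsPrin (K.sub (Set.Icc 1 3) pa) 0 3 s'
         (fun i => if i = 1 then ((q.2.1 : ℤ) + q.2.2.1).toNat
                   else if i = 2 then a 3 else ((a 4 : ℤ) - q.2.2.1).toNat) z ∧
       inComp K (Set.Icc 2 3) z.1 v) ∧
    (∃ stil : (K.sub (Set.Icc 2 3) v).V, IsSource (K.sub (Set.Icc 2 3) v) stil ∧
       applyStr (K.sub (Set.Icc 2 3) v) (diagStr q.2.2.2) stil =
         some ⟨v, Relation.ReflTransGen.refl⟩)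

/-- The polytope of descriptions for a symmetric `A_4`-crystal with parameter
`(c1, c2, c2, c1)`. -/
def QuadC (c1 c2 : ℕ) : Set (ℕ × ℕ × ℤ × ℕ) :=
  {q | q.1 ≤ c1 ∧ q.2.1 ≤ c2 ∧ -(q.2.1 : ℤ) ≤ q.2.2.1 ∧
       q.2.2.1 ≤ (c1 : ℤ) - (q.1 : ℤ) ∧ (q.2.2.2 : ℤ) ≤ (c2 : ℤ) + q.2.2.1}

end

/-- Partial operators `F i` with string lengths `φ i` (towards the end of the `i`-string) and
`ε i` (towards its beginning). -/
structure ColorOps (V : Type) where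
  F : ℕ → V → Option V
  φ : ℕ → V → ℕ
  ε : ℕ → V → ℕ
  inj : ∀ {i u u' v}, F i u = some v → F i u' = some v → u = u'
  exists_F : ∀ {i u}, 0 < φ i u → ∃ v, F i u = some v
  exists_pred : ∀ {i v}, 0 < ε i v → ∃ u, F i u = some v
  φ_F : ∀ {i u v}, F i u = some v → φ i u = φ i v + 1
  ε_F : ∀ {i u v}, F i u = some v → ε i v = ε i u + 1

namespace ColorOps

variable {V : Type}

/-- The local axioms relating two neighboring colors. -/
structure NeighborAx (C : ColorOps V) (i j : ℕ) : Prop where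
  label : ∀ {u v}, C.F i u = some v →
    (C.φ j v = C.φ j u + 1 ∧ C.ε j v = C.ε j u) ∨ (C.φ j v = C.φ j u ∧ C.ε j u = C.ε j v + 1)
  square_down : ∀ {u v v'}, C.F i u = some v → C.F j u = some v' → C.φ j v = C.φ j u →
    C.φ i v' = C.φ i u + 1 ∧ ∃ w, C.F j v = some w ∧ C.F i v' = some w
  square_up : ∀ {u u' v}, C.F i u = some v → C.F j u' = some v → C.φ j v = C.φ j u + 1 →
    C.φ i v = C.φ i u' ∧ ∃ w, C.F j w = some u ∧ C.F i w = some u'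
  verma_down : ∀ {u v v'}, C.F i u = some v → C.F j u = some v' →
    C.φ j v = C.φ j u + 1 → C.φ i v' = C.φ i u + 1 →
    ∃ p q p' q' w, C.F j v = some p ∧ C.F j p = some q ∧ C.F i q = some w ∧
      C.F i v' = some p' ∧ C.F i p' = some q' ∧ C.F j q' = some w
  verma_up : ∀ {u u' v}, C.F i u = some v → C.F j u' = some v →
    C.φ j v = C.φ j u → C.φ i v = C.φ i u' →
    ∃ p q x y w, C.F j p = some u ∧ C.F j q = some p ∧ C.F i w = some q ∧
      C.F i x = some u' ∧ C.F i y = some x ∧ C.F j w = some y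

/-- The local axioms relating two colors at distance at least two. -/
structure FarAx (C : ColorOps V) (i j : ℕ) : Prop where
  const : ∀ {u v}, C.F i u = some v → C.φ j v = C.φ j u ∧ C.ε j v = C.ε j u
  square_down : ∀ {u v v'}, C.F i u = some v → C.F j u = some v' →
    ∃ w, C.F j v = some w ∧ C.F i v' = some w
  square_up : ∀ {u x v}, C.F i u = some v → C.F j x = some v →
    ∃ w, C.F j w = some u ∧ C.F i w = some x

/-- The local crystal axioms for all pairs of colors in `I`. -/
def LocalAx (C : ColorOps V) (I : Set ℕ) : Prop :=
  (∀ i ∈ I, ∀ j ∈ I, Neighb i j → C.NeighborAx i j) ∧ (∀ i ∈ I, ∀ j ∈ I, Far i j → C.FarAx i j)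

variable {C : ColorOps V}

theorem F_eq_none {i : ℕ} {u : V} (h : C.φ i u = 0) : C.F i u = none := by
  rw [Option.eq_none_iff_forall_ne_some]
  intro v hv
  have := C.φ_F hv
  omega

/-- The operators of `C.snoc`. -/
def snocF (C : ColorOps V) (i : ℕ) (x : V × ℕ) : Option (V × ℕ) :=
  if x.2 = i ∧ C.φ i x.1 = 0 then some (x.1, i + 1)
  else if x.2 = i + 1 ∧ C.φ i x.1 ≤ 1 then none
  else (C.F i x.1).map (·, x.2)

theorem snocF_iff {i c c' : ℕ} {b b' : V} : C.snocF i (b, c) = some (b', c') ↔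
    (c' = c ∧ C.F i b = some b' ∧ (c = i + 1 → 2 ≤ C.φ i b)) ∨
      (c = i ∧ c' = i + 1 ∧ b' = b ∧ C.φ i b = 0) := by
  unfold snocF
  rcases Nat.eq_zero_or_pos (C.φ i b) with h0 | h0
  · have := F_eq_none h0
    split_ifs <;> simp <;> grind
  · split_ifs <;> simp <;> grind

/-- The tensor product with the crystal of one letter on the right. -/
def snoc (C : ColorOps V) : ColorOps (V × ℕ) where
  F := C.snocF
  φ i x := (if x.2 = i then 1 else 0) + (C.φ i x.1 - if x.2 = i + 1 then 1 else 0)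
  ε i x := C.ε i x.1 + ((if x.2 = i + 1 then 1 else 0) - C.φ i x.1)
  inj := by
    rintro i ⟨b, c⟩ ⟨b', c'⟩ ⟨d, e⟩ h h'
    rw [snocF_iff] at h h'
    have := @C.inj i
    have := @C.φ_F i
    grind
  exists_F := by
    rintro i ⟨b, c⟩ h
    simp only [Prod.exists, snocF_iff] at h ⊢
    by_cases h1 : c = i ∧ C.φ i b = 0
    · exact ⟨b, i + 1, by grind⟩
    · obtain ⟨a, ha⟩ := C.exists_F (i := i) (u := b) (by grind)
      exact ⟨a, c, by grind⟩
  exists_pred := by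
    rintro i ⟨b, c⟩ h
    simp only [Prod.exists, snocF_iff] at h ⊢
    by_cases h1 : c = i + 1 ∧ C.φ i b = 0
    · exact ⟨b, i, by grind⟩
    · obtain ⟨a, ha⟩ := C.exists_pred (i := i) (v := b) (by grind)
      have := C.φ_F ha
      exact ⟨a, c, by grind⟩
  φ_F := by
    rintro i ⟨b, c⟩ ⟨d, e⟩ h
    rw [snocF_iff] at h
    have := @C.φ_F i
    grind
  ε_F := by
    rintro i ⟨b, c⟩ ⟨d, e⟩ h
    rw [snocF_iff] at h
    have := @C.φ_F i
    have := @C.ε_F i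
    grind

theorem snoc_F_iff {i c c' : ℕ} {b b' : V} : C.snoc.F i (b, c) = some (b', c') ↔
    (c' = c ∧ C.F i b = some b' ∧ (c = i + 1 → 2 ≤ C.φ i b)) ∨
      (c = i ∧ c' = i + 1 ∧ b' = b ∧ C.φ i b = 0) :=
  snocF_iff

theorem snoc_φ {i c : ℕ} {b : V} : C.snoc.φ i (b, c) =
    (if c = i then 1 else 0) + (C.φ i b - if c = i + 1 then 1 else 0) := rfl

theorem snoc_ε {i c : ℕ} {b : V} : C.snoc.ε i (b, c) =
    C.ε i b + ((if c = i + 1 then 1 else 0) - C.φ i b) := rfl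

variable {i j : ℕ}

theorem NeighborAx.snoc_label (hij : Neighb i j) (N : C.NeighborAx i j) {u v : V × ℕ}
    (h : C.snoc.F i u = some v) :
    (C.snoc.φ j v = C.snoc.φ j u + 1 ∧ C.snoc.ε j v = C.snoc.ε j u) ∨
      (C.snoc.φ j v = C.snoc.φ j u ∧ C.snoc.ε j u = C.snoc.ε j v + 1) := by
  obtain ⟨b, c⟩ := u
  obtain ⟨b₁, c₁⟩ := v
  unfold Neighb at hij
  simp only [snoc_F_iff, snoc_φ, snoc_ε] at h ⊢
  rcases h with ⟨rfl, h, hc⟩ | ⟨rfl, rfl, rfl, h⟩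
  · have := N.label h
    grind
  · grind

theorem NeighborAx.snoc_square_down (hij : Neighb i j) (N : C.NeighborAx i j)
    {u v v' : V × ℕ} (h : C.snoc.F i u = some v) (h' : C.snoc.F j u = some v')
    (hl : C.snoc.φ j v = C.snoc.φ j u) :
    C.snoc.φ i v' = C.snoc.φ i u + 1 ∧ ∃ w, C.snoc.F j v = some w ∧ C.snoc.F i v' = some w := by
  obtain ⟨b, c⟩ := u
  obtain ⟨b₁, c₁⟩ := v
  obtain ⟨b₂, c₂⟩ := v'
  unfold Neighb at hij
  simp only [snoc_F_iff, snoc_φ, Prod.exists] at h h' hl ⊢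
  rcases h with ⟨rfl, h, hc⟩ | ⟨rfl, rfl, rfl, h⟩ <;>
    rcases h' with ⟨rfl, h', hc'⟩ | ⟨rfl, rfl, rfl, h'⟩
  · have h0 := C.φ_F h
    have h0' := C.φ_F h'
    have hlab := N.label h
    obtain ⟨h1, w, hw, hw'⟩ := N.square_down h h' (by grind)
    exact ⟨by grind, w, c₂, by grind⟩
  · have hlab := N.label h
    exact ⟨by grind, b₁, c₁ + 1, by grind⟩
  · exfalso
    grind
  · grind

theorem NeighborAx.snoc_square_up (hij : Neighb i j) (N : C.NeighborAx i j)
    (N' : C.NeighborAx j i)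
    {u u' v : V × ℕ} (h : C.snoc.F i u = some v) (h' : C.snoc.F j u' = some v)
    (hl : C.snoc.φ j v = C.snoc.φ j u + 1) :
    C.snoc.φ i v = C.snoc.φ i u' ∧ ∃ w, C.snoc.F j w = some u ∧ C.snoc.F i w = some u' := by
  obtain ⟨b, c⟩ := v
  obtain ⟨b₁, c₁⟩ := u
  obtain ⟨b₂, c₂⟩ := u'
  unfold Neighb at hij
  simp only [snoc_F_iff, snoc_φ, Prod.exists] at h h' hl ⊢
  rcases h with ⟨rfl, h, hc⟩ | ⟨rfl, rfl, rfl, h⟩ <;>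
    rcases h' with ⟨rfl, h', hc'⟩ | ⟨e₁, e₂, e₃, h'⟩
  · have h0 := C.φ_F h
    have h0' := C.φ_F h'
    have hlab := N.label h
    obtain ⟨h1, w, hw, hw'⟩ := N.square_up h h' (by grind)
    have h2 := C.φ_F hw
    have h2' := C.φ_F hw'
    exact ⟨by grind, w, c, by grind⟩
  · subst e₁ e₂ e₃
    exfalso
    grind
  · have h0' := C.φ_F h'
    have hlab := N'.label h'
    exact ⟨by grind, b₂, c₁, by grind⟩
  · grind

theorem NeighborAx.snoc_verma_down (hij : j = i + 1) (N : C.NeighborAx i j)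
    (N' : C.NeighborAx j i)
    {u v v' : V × ℕ} (h : C.snoc.F i u = some v) (h' : C.snoc.F j u = some v')
    (hl : C.snoc.φ j v = C.snoc.φ j u + 1) (hl' : C.snoc.φ i v' = C.snoc.φ i u + 1) :
    ∃ p q p' q' w, C.snoc.F j v = some p ∧ C.snoc.F j p = some q ∧ C.snoc.F i q = some w ∧
      C.snoc.F i v' = some p' ∧ C.snoc.F i p' = some q' ∧ C.snoc.F j q' = some w := by
  obtain ⟨b, c⟩ := u
  obtain ⟨b₁, c₁⟩ := v
  obtain ⟨b₂, c₂⟩ := v'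
  subst hij
  simp only [snoc_F_iff, snoc_φ] at h h' hl hl'
  rcases h with ⟨rfl, h, hc⟩ | ⟨rfl, rfl, rfl, h⟩ <;>
    rcases h' with ⟨rfl, h', hc'⟩ | ⟨e₁, e₂, e₃, h'⟩
  · have h0 := C.φ_F h
    have h0' := C.φ_F h'
    have hlab := N.label h
    have hlab' := N'.label h'
    obtain ⟨p, q, p', q', w, h1, h2, h3, h4, h5, h6⟩ :=
      N.verma_down h h' (by grind) (by grind)
    have := C.φ_F h1
    have := C.φ_F h2
    have := C.φ_F h3
    have := C.φ_F h4
    have := C.φ_F h5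
    have := C.φ_F h6
    have := N.label h3
    have := N'.label h6
    refine ⟨(p, c₂), (q, c₂), (p', c₂), (q', c₂), (w, c₂), ?_⟩
    simp only [snoc_F_iff]
    grind
  · subst e₁ e₂ e₃
    have h0 := C.φ_F h
    have hlab := N.label h
    obtain ⟨p, hp⟩ := C.exists_F (i := i + 1) (u := b₁) (by grind)
    obtain ⟨d, hd⟩ := C.exists_F (i := i) (u := b₁) (by grind)
    have hpl : C.φ i p = C.φ i b₁ := by
      rcases N'.label hp with hq | hq
      · obtain ⟨e, he⟩ := C.exists_pred (i := i) (v := p) (by have := C.ε_F h; omega)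
        obtain ⟨-, z, hz, hz'⟩ := N'.square_up hp he hq.1
        obtain rfl := C.inj hz h
        have := C.φ_F hz'
        omega
      · exact hq.1
    obtain ⟨h1, w, hw, hw'⟩ := N'.square_down hp hd hpl
    have := C.φ_F hp
    have := C.φ_F hd
    refine ⟨(p, i + 1), (p, i + 2), (b₁, i + 2), (d, i + 2), (w, i + 2), ?_⟩
    simp only [snoc_F_iff]
    grind
  · have h0' := C.φ_F h'
    have hlab := N'.label h'
    obtain ⟨p', hp'⟩ := C.exists_F (i := c₂) (u := b₂) (by grind)
    have hpl : C.φ (c₂ + 1) p' = C.φ (c₂ + 1) b₂ := by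
      rcases N.label hp' with hq | hq
      · obtain ⟨e, he⟩ := C.exists_pred (i := c₂ + 1) (v := p') (by have := C.ε_F h'; omega)
        obtain ⟨-, z, hz, hz'⟩ := N.square_up hp' he hq.1
        obtain rfl := C.inj hz h'
        have := C.φ_F hz'
        omega
      · exact hq.1
    have := C.φ_F hp'
    rcases Nat.eq_zero_or_pos (C.φ (c₂ + 1) b₂) with h2 | h2
    · refine ⟨(b₂, c₂ + 1), (b₂, c₂ + 2), (p', c₂), (p', c₂ + 1), (p', c₂ + 2), ?_⟩
      simp only [snoc_F_iff]
      grind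
    · obtain ⟨q, hq⟩ := C.exists_F h2
      obtain ⟨h1, w, hw, hw'⟩ := N.square_down hp' hq hpl
      refine ⟨(b₂, c₂ + 1), (q, c₂ + 1), (p', c₂), (p', c₂ + 1), (w, c₂ + 1), ?_⟩
      simp only [snoc_F_iff]
      grind
  · grind

theorem NeighborAx.snoc_verma_up (hij : j = i + 1) (N : C.NeighborAx i j)
    (N' : C.NeighborAx j i)
    {u u' v : V × ℕ} (h : C.snoc.F i u = some v) (h' : C.snoc.F j u' = some v)
    (hl : C.snoc.φ j v = C.snoc.φ j u) (hl' : C.snoc.φ i v = C.snoc.φ i u') :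
    ∃ p q p' q' w, C.snoc.F j p = some u ∧ C.snoc.F j q = some p ∧ C.snoc.F i w = some q ∧
      C.snoc.F i p' = some u' ∧ C.snoc.F i q' = some p' ∧ C.snoc.F j w = some q' := by
  obtain ⟨b, c⟩ := v
  obtain ⟨b₁, c₁⟩ := u
  obtain ⟨b₂, c₂⟩ := u'
  subst hij
  simp only [snoc_F_iff, snoc_φ] at h h' hl hl'
  rcases h with ⟨rfl, h, hc⟩ | ⟨rfl, rfl, rfl, h⟩ <;>
    rcases h' with ⟨rfl, h', hc'⟩ | ⟨e₁, e₂, e₃, h'⟩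
  · have h0 := C.φ_F h
    have h0' := C.φ_F h'
    have e0 := C.ε_F h
    have e0' := C.ε_F h'
    rcases N.label h with ⟨hlab, -⟩ | ⟨hlab, -⟩
    · obtain ⟨h1, w, hw, hw'⟩ := N.square_up h h' hlab
      have := C.φ_F hw
      have := C.φ_F hw'
      have := C.ε_F hw
      have := C.ε_F hw'
      have := N'.label h'
      obtain ⟨z, hz⟩ := C.exists_pred (i := i) (v := w) (by grind)
      have hz0 := C.φ_F hz
      have hzl : C.φ (i + 1) z = 0 := by
        rcases N.label hz with hq | hq
        · grind
        · obtain ⟨e, he⟩ := C.exists_F (i := i + 1) (u := z) (by omega)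
          obtain ⟨h2, y, hy, hy'⟩ := N.square_down hz he hq.1
          have := C.φ_F hy'
          grind
      refine ⟨(b₁, i + 1), (w, i + 1), (w, c), (z, c), (z, i + 1), ?_⟩
      simp only [snoc_F_iff]
      grind
    · rcases N'.label h' with ⟨hlab', -⟩ | ⟨hlab', -⟩
      · obtain ⟨h1, w, hw, hw'⟩ := N'.square_up h' h hlab'
        have := C.φ_F hw
        have := C.φ_F hw'
        have := C.ε_F hw
        have := C.ε_F hw'
        have := N.label h
        obtain ⟨z, hz⟩ := C.exists_pred (i := i + 1) (v := w) (by grind)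
        have hz0 := C.φ_F hz
        have hzl : C.φ i z = 0 := by
          rcases N'.label hz with hq | hq
          · grind
          · obtain ⟨e, he⟩ := C.exists_F (i := i) (u := z) (by omega)
            obtain ⟨h2, y, hy, hy'⟩ := N'.square_down hz he hq.1
            have := C.φ_F hy'
            grind
        refine ⟨(w, c), (z, c), (b₂, i), (w, i), (z, i), ?_⟩
        simp only [snoc_F_iff]
        grind
      · obtain ⟨p, q, p', q', w, h1, h2, h3, h4, h5, h6⟩ := N.verma_up h h' hlab hlab'
        have := C.φ_F h1
        have := C.φ_F h2
        have := C.φ_F h3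
        have := C.φ_F h4
        have := C.φ_F h5
        have := C.φ_F h6
        have := N.label h3
        have := N'.label h6
        refine ⟨(p, c), (q, c), (p', c), (q', c), (w, c), ?_⟩
        simp only [snoc_F_iff]
        grind
  · subst e₁ e₂ e₃
    have h0 := C.φ_F h
    have e0 := C.ε_F h
    have hlab := N.label h
    obtain ⟨p, hp⟩ := C.exists_pred (i := i + 1) (v := b₁) (by grind)
    have hp0 := C.φ_F hp
    have hpl : C.φ i p = 0 := by
      rcases N'.label hp with hq | hq
      · grind
      · obtain ⟨e, he⟩ := C.exists_F (i := i) (u := p) (by grind)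
        obtain ⟨h2, y, hy, hy'⟩ := N'.square_down hp he hq.1
        have := C.φ_F hy'
        grind
    refine ⟨(b₁, i + 1), (p, i + 1), (b, i), (b₁, i), (p, i), ?_⟩
    simp only [snoc_F_iff]
    grind
  · exfalso
    grind
  · grind

theorem NeighborAx.snoc (hij : Neighb i j) (N : C.NeighborAx i j) (N' : C.NeighborAx j i) :
    C.snoc.NeighborAx i j where
  label := N.snoc_label hij
  square_down := N.snoc_square_down hij
  square_up := N.snoc_square_up hij N'
  verma_down h h' hl hl' := by
    rcases hij with hij | hij
    · exact N.snoc_verma_down hij.symm N' h h' hl hl'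
    · obtain ⟨p, q, p', q', w, h1, h2, h3, h4, h5, h6⟩ :=
        N'.snoc_verma_down hij.symm N h' h hl' hl
      exact ⟨p', q', p, q, w, h4, h5, h6, h1, h2, h3⟩
  verma_up h h' hl hl' := by
    rcases hij with hij | hij
    · exact N.snoc_verma_up hij.symm N' h h' hl hl'
    · obtain ⟨p, q, p', q', w, h1, h2, h3, h4, h5, h6⟩ :=
        N'.snoc_verma_up hij.symm N h' h hl' hl
      exact ⟨p', q', p, q, w, h4, h5, h6, h1, h2, h3⟩

theorem FarAx.snoc (hij : Far i j) (A : C.FarAx i j) (A' : C.FarAx j i) : C.snoc.FarAx i j where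
  const := by
    rintro ⟨b, c⟩ ⟨b₁, c₁⟩ h
    unfold Far at hij
    simp only [snoc_F_iff, snoc_φ, snoc_ε] at h ⊢
    rcases h with ⟨rfl, h, hc⟩ | ⟨rfl, rfl, rfl, h⟩
    · simp [A.const h]
    · grind
  square_down := by
    rintro ⟨b, c⟩ ⟨b₁, c₁⟩ ⟨b₂, c₂⟩ h h'
    unfold Far at hij
    simp only [snoc_F_iff, Prod.exists] at h h' ⊢
    rcases h with ⟨rfl, h, hc⟩ | ⟨rfl, rfl, rfl, h⟩ <;>
      rcases h' with ⟨rfl, h', hc'⟩ | ⟨rfl, rfl, rfl, h'⟩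
    · obtain ⟨w, hw, hw'⟩ := A.square_down h h'
      have := A.const h
      have := A'.const h'
      exact ⟨w, c₂, by grind⟩
    · have := A.const h
      exact ⟨b₁, c₁ + 1, by grind⟩
    · have := A'.const h'
      exact ⟨b₂, c₂ + 1, by grind⟩
    · grind
  square_up := by
    rintro ⟨b₁, c₁⟩ ⟨b₂, c₂⟩ ⟨b, c⟩ h h'
    unfold Far at hij
    simp only [snoc_F_iff, Prod.exists] at h h' ⊢
    rcases h with ⟨rfl, h, hc⟩ | ⟨rfl, rfl, rfl, h⟩ <;>
      rcases h' with ⟨rfl, h', hc'⟩ | ⟨e₁, e₂, e₃, h'⟩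
    · obtain ⟨w, hw, hw'⟩ := A.square_up h h'
      have := A.const h
      have := A'.const h'
      have := A.const hw'
      have := A'.const hw
      exact ⟨w, c, by grind⟩
    · subst e₁ e₂ e₃
      have := A.const h
      exact ⟨b₁, c₂, by grind⟩
    · have := A'.const h'
      exact ⟨b₂, c₁, by grind⟩
    · grind

theorem LocalAx.snoc {I : Set ℕ} (hC : C.LocalAx I) : C.snoc.LocalAx I :=
  ⟨fun i hi j hj hij => (hC.1 i hi j hj hij).snoc hij (hC.1 j hj i hi hij.symm),
    fun i hi j hj hij => (hC.2 i hi j hj hij).snoc hij (hC.2 j hj i hi hij.symm)⟩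

end ColorOps

namespace ColorOps

variable {V V' : Type} {A : ColorOps V} {B : ColorOps V'} {a₀ : V} {b₀ : V'} {I : Set ℕ}

/-- `Sync A B I a₀ b₀ r u u'` says that one and the same string of `r` colors in `I` leads
from `a₀` to `u` in `A` and from `b₀` to `u'` in `B`. -/
inductive Sync (A : ColorOps V) (B : ColorOps V') (I : Set ℕ) (a₀ : V) (b₀ : V') :
    ℕ → V → V' → Prop
  | base : Sync A B I a₀ b₀ 0 a₀ b₀
  | step {r i u u' v v'} : Sync A B I a₀ b₀ r u u' → i ∈ I → A.F i u = some v →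
      B.F i u' = some v' → Sync A B I a₀ b₀ (r + 1) v v'

theorem Sync.swap {r : ℕ} {u : V} {u' : V'} (h : Sync A B I a₀ b₀ r u u') :
    Sync B A I b₀ a₀ r u' u := by
  induction h with
  | base => exact .base
  | step _ hi hv hv' ih => exact ih.step hi hv' hv

/-- `a₀` and `b₀` are sources for the colors in `I`, with the same string lengths, and the local
axioms hold on both sides. -/
structure Matched (A : ColorOps V) (B : ColorOps V') (I : Set ℕ) (a₀ : V) (b₀ : V') : Prop where
  left : A.LocalAx I
  right : B.LocalAx I
  ε_left : ∀ i ∈ I, A.ε i a₀ = 0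
  ε_right : ∀ i ∈ I, B.ε i b₀ = 0
  φ_eq : ∀ i ∈ I, A.φ i a₀ = B.φ i b₀

theorem Matched.swap (h : Matched A B I a₀ b₀) : Matched B A I b₀ a₀ :=
  ⟨h.right, h.left, h.ε_right, h.ε_left, fun i hi => (h.φ_eq i hi).symm⟩

theorem eq_or_neighb_or_far (i j : ℕ) : i = j ∨ Neighb i j ∨ Far i j := by
  unfold Neighb Far
  omega

theorem Sync.weight (M : Matched A B I a₀ b₀) {r : ℕ} {u : V} {u' : V'}
    (h : Sync A B I a₀ b₀ r u u') {i : ℕ} (hi : i ∈ I) :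
    A.φ i u + B.ε i u' = B.φ i u' + A.ε i u := by
  induction h with
  | base => rw [M.ε_left i hi, M.ε_right i hi, M.φ_eq i hi]
  | @step r j u u' v v' _ hj hv hv' ih =>
    rcases eq_or_neighb_or_far j i with rfl | hij | hij
    · have := A.φ_F hv
      have := A.ε_F hv
      have := B.φ_F hv'
      have := B.ε_F hv'
      omega
    · have := (M.left.1 j hj i hi hij).label hv
      have := (M.right.1 j hj i hi hij).label hv'
      omega
    · have := (M.left.2 j hj i hi hij).const hv
      have := (M.right.2 j hj i hi hij).const hv'
      omega

/-- Backward steps from vertices of rank `r` lift from `A` to `B`. -/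
def PredLift (A : ColorOps V) (B : ColorOps V') (I : Set ℕ) (a₀ : V) (b₀ : V') (r : ℕ) : Prop :=
  ∀ u u', Sync A B I a₀ b₀ r u u' → ∀ i ∈ I, ∀ x, A.F i x = some u →
    ∃ x' r', r = r' + 1 ∧ B.F i x' = some u' ∧ Sync A B I a₀ b₀ r' x x'

theorem predLift_of_lt (M : Matched A B I a₀ b₀) (r : ℕ)
    (hl : ∀ r' < r, PredLift A B I a₀ b₀ r')
    (hφ : ∀ r' < r, ∀ u u', Sync A B I a₀ b₀ r' u u' → ∀ i ∈ I, A.φ i u = B.φ i u') :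
    PredLift A B I a₀ b₀ r := by
  intro u u' h i hi x hx
  rcases h with _ | @⟨r₀, j, v, v', _, _, h, hj, hv, hv'⟩
  · have := A.ε_F hx
    have := M.ε_left i hi
    omega
  have lift : ∀ {k r u u'}, k ∈ I → r < r₀ + 1 → Sync A B I a₀ b₀ r u u' → ∀ {v},
      A.F k u = some v → ∃ v', B.F k u' = some v' ∧ Sync A B I a₀ b₀ (r + 1) v v' := by
    intro k r u u' hk hr h v hv
    have := A.φ_F hv
    have := hφ r hr u u' h k hk
    obtain ⟨v', hv'⟩ := B.exists_F (i := k) (u := u') (by omega)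
    exact ⟨v', hv', h.step hk hv hv'⟩
  have φ_v := A.φ_F hv
  have φ_x := A.φ_F hx
  have square : (∃ w, A.F j w = some x ∧ A.F i w = some v) →
      (∀ w r' w' x', A.F j w = some x → A.F i w = some v → r' + 1 = r₀ →
        B.F j w' = some x' → B.F i w' = some v' →
        Sync A B I a₀ b₀ r' w w' → Sync A B I a₀ b₀ (r' + 1) x x' →
        ∃ z, B.F j v' = some z ∧ B.F i x' = some z) →
      ∃ x' r', r₀ + 1 = r' + 1 ∧ B.F i x' = some u' ∧ Sync A B I a₀ b₀ r' x x' := by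
    rintro ⟨w, hw, hw'⟩ hz
    obtain ⟨wB, r₁, rfl, hwB, hS⟩ := hl r₀ (by omega) v v' h i hi w hw'
    obtain ⟨xB, hxB, hS'⟩ := lift hj (by omega) hS hw
    obtain ⟨z, hz, hz'⟩ := hz w r₁ wB xB hw hw' rfl hxB hwB hS hS'
    obtain rfl : z = u' := by simpa [hv'] using hz.symm
    exact ⟨xB, r₁ + 1, rfl, hz', hS'⟩
  rcases eq_or_neighb_or_far i j with rfl | hij | hij
  · obtain rfl := A.inj hv hx
    exact ⟨v', r₀, rfl, hv', h⟩
  · have NA := M.left.1 i hi j hj hij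
    have NA' := M.left.1 j hj i hi hij.symm
    have NB := M.right.1 i hi j hj hij
    have NB' := M.right.1 j hj i hi hij.symm
    rcases NA.label hx with ⟨h1, -⟩ | ⟨h1, -⟩
    · obtain ⟨h2, w, hw⟩ := NA.square_up hx hv h1
      refine square ⟨w, hw⟩ fun w r' w' x' e1 e2 hr e3 e4 hS hS' => ?_
      have := hφ r' (by omega) _ _ hS i hi
      have := hφ (r' + 1) (by omega) _ _ hS' i hi
      have := A.φ_F e2
      obtain ⟨-, z, hz, hz'⟩ := NB'.square_down e3 e4 (by omega)
      exact ⟨z, hz', hz⟩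
    rcases NA'.label hv with ⟨h2, -⟩ | ⟨h2, -⟩
    · obtain ⟨h3, w, hw⟩ := NA'.square_up hv hx h2
      refine square ⟨w, hw.symm⟩ fun w r' w' x' e1 e2 hr e3 e4 hS hS' => ?_
      have := hφ r' (by omega) _ _ hS j hj
      have := hφ r₀ (by omega) _ _ h j hj
      have := A.φ_F e1
      obtain ⟨-, z, hz, hz'⟩ := NB.square_down e4 e3 (by omega)
      exact ⟨z, hz, hz'⟩
    · obtain ⟨p, q, p', q', w, e1, e2, e3, e4, e5, e6⟩ := NA.verma_up hx hv h1 h2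
      have key : p ≠ p' := by
        rintro rfl
        have := A.φ_F e1
        have := A.φ_F e4
        have := (NA.square_down e4 e1 (by omega)).1
        omega
      have l1 : A.φ j q = A.φ j w + 1 := by
        rcases NA.label e3 with ⟨h3, -⟩ | ⟨h3, -⟩
        · exact h3
        · obtain ⟨-, z, hz, hz'⟩ := NA.square_down e3 e6 h3
          exact absurd (Option.some_injective _ ((e2.symm.trans hz).trans (hz'.symm.trans e5))) key
      have l2 : A.φ i q' = A.φ i w + 1 := by
        rcases NA'.label e6 with ⟨h3, -⟩ | ⟨h3, -⟩
        · exact h3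
        · obtain ⟨-, z, hz, hz'⟩ := NA'.square_down e6 e3 h3
          exact absurd (Option.some_injective _ ((e2.symm.trans hz').trans (hz.symm.trans e5))) key
      obtain ⟨p'B, r₁, rfl, f4, S1⟩ := hl r₀ (by omega) v v' h i hi p' e4
      obtain ⟨q'B, r₂, rfl, f5, S2⟩ := hl r₁ (by omega) _ _ S1 i hi q' e5
      obtain ⟨wB, r₃, rfl, f6, S3⟩ := hl r₂ (by omega) _ _ S2 j hj w e6
      obtain ⟨qB, f3, T1⟩ := lift hi (by omega) S3 e3
      obtain ⟨pB, f2, T2⟩ := lift hj (by omega) T1 e2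
      obtain ⟨xB, f1, T3⟩ := lift hj (by omega) T2 e1
      have := hφ _ (by omega) _ _ S3 i hi
      have := hφ _ (by omega) _ _ S3 j hj
      have := hφ _ (by omega) _ _ S2 i hi
      have := hφ _ (by omega) _ _ T1 j hj
      obtain ⟨P, Q, P', Q', W, g1, g2, g3, g4, g5, g6⟩ :=
        NB.verma_down f3 f6 (by omega) (by omega)
      refine ⟨xB, _, rfl, ?_, T3⟩
      grind
  · refine square ((M.left.2 i hi j hj hij).square_up hx hv)
      fun w r' w' x' e1 e2 hr e3 e4 hS hS' => (M.right.2 i hi j hj hij).square_down e4 e3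

theorem predLift_and_ε_eq (M : Matched A B I a₀ b₀) (r : ℕ) :
    PredLift A B I a₀ b₀ r ∧ PredLift B A I b₀ a₀ r ∧
      ∀ u u', Sync A B I a₀ b₀ r u u' → ∀ i ∈ I, A.ε i u = B.ε i u' := by
  induction r using Nat.strong_induction_on with
  | _ r ih =>
    have hφ : ∀ r' < r, ∀ u u', Sync A B I a₀ b₀ r' u u' → ∀ i ∈ I, A.φ i u = B.φ i u' := by
      intro r' hr u u' h i hi
      have := (ih r' hr).2.2 u u' h i hi
      have := h.weight M hi
      omega
    have h1 := predLift_of_lt M r (fun r' hr => (ih r' hr).1) hφ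
    have h2 := predLift_of_lt M.swap r (fun r' hr => (ih r' hr).2.1)
      (fun r' hr u u' h i hi => (hφ r' hr u' u h.swap i hi).symm)
    refine ⟨h1, h2, fun u u' h i hi => ?_⟩
    rcases Nat.eq_zero_or_pos (A.ε i u) with h0 | h0
    · rcases Nat.eq_zero_or_pos (B.ε i u') with h0' | h0'
      · omega
      · obtain ⟨x', hx'⟩ := B.exists_pred h0'
        obtain ⟨x, r', rfl, hx, hS⟩ := h2 u' u h.swap i hi x' hx'
        have := A.ε_F hx
        omega
    · obtain ⟨x, hx⟩ := A.exists_pred h0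
      obtain ⟨x', r', rfl, hx', hS⟩ := h1 u u' h i hi x hx
      have := A.ε_F hx
      have := B.ε_F hx'
      have := (ih r' (by omega)).2.2 x x' hS i hi
      omega

theorem Sync.ε_eq (M : Matched A B I a₀ b₀) {r i : ℕ} {u : V} {u' : V'}
    (h : Sync A B I a₀ b₀ r u u') (hi : i ∈ I) : A.ε i u = B.ε i u' :=
  (predLift_and_ε_eq M r).2.2 u u' h i hi

theorem Sync.φ_eq (M : Matched A B I a₀ b₀) {r i : ℕ} {u : V} {u' : V'}
    (h : Sync A B I a₀ b₀ r u u') (hi : i ∈ I) : A.φ i u = B.φ i u' := by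
  have := h.ε_eq M hi
  have := h.weight M hi
  omega

theorem Sync.succ (M : Matched A B I a₀ b₀) {r i : ℕ} {u v : V} {u' : V'}
    (h : Sync A B I a₀ b₀ r u u') (hi : i ∈ I) (hv : A.F i u = some v) :
    ∃ v', B.F i u' = some v' ∧ Sync A B I a₀ b₀ (r + 1) v v' := by
  have := A.φ_F hv
  have := h.φ_eq M hi
  obtain ⟨v', hv'⟩ := B.exists_F (i := i) (u := u') (by omega)
  exact ⟨v', hv', h.step hi hv hv'⟩

theorem Sync.pred (M : Matched A B I a₀ b₀) {r i : ℕ} {u x : V} {u' : V'}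
    (h : Sync A B I a₀ b₀ r u u') (hi : i ∈ I) (hx : A.F i x = some u) :
    ∃ x' r', r = r' + 1 ∧ B.F i x' = some u' ∧ Sync A B I a₀ b₀ r' x x' :=
  (predLift_and_ε_eq M r).1 u u' h i hi x hx

theorem Sync.right_unique (M : Matched A B I a₀ b₀) {r r₂ : ℕ} {u : V} {u' u₂ : V'}
    (h : Sync A B I a₀ b₀ r u u') (h₂ : Sync A B I a₀ b₀ r₂ u u₂) : u' = u₂ := by
  induction h generalizing r₂ u₂ with
  | base =>
    rcases h₂ with _ | ⟨_, hi, hv, _⟩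
    · rfl
    · have := A.ε_F hv
      have := M.ε_left _ hi
      omega
  | step _ hi hv hv' ih =>
    obtain ⟨x', r', -, hx', hS⟩ := h₂.pred M hi hv
    obtain rfl := ih hS
    exact Option.some_injective _ (hv'.symm.trans hx')

theorem Sync.left_unique (M : Matched A B I a₀ b₀) {r r₂ : ℕ} {u u₂ : V} {u' : V'}
    (h : Sync A B I a₀ b₀ r u u') (h₂ : Sync A B I a₀ b₀ r₂ u₂ u') : u = u₂ :=
  h.swap.right_unique M.swap h₂.swap

/-- Apply a string of operators, head first. -/
def run (C : ColorOps V) : List ℕ → V → Option V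
  | [], v => some v
  | i :: L, v => (C.F i v).bind (C.run L)

theorem run_append (C : ColorOps V) (L L' : List ℕ) (v : V) :
    C.run (L ++ L') v = (C.run L v).bind (C.run L') := by
  induction L generalizing v with
  | nil => rfl
  | cons i L ih =>
    simp only [List.cons_append, run, Option.bind_assoc]
    congr 1
    exact funext ih

theorem Sync.run_right (M : Matched A B I a₀ b₀) {L : List ℕ} (hL : ∀ i ∈ L, i ∈ I) {r : ℕ}
    {u : V} {u' v' : V'} (h : Sync A B I a₀ b₀ r u u') (hv : B.run L u' = some v') :
    ∃ v r', A.run L u = some v ∧ Sync A B I a₀ b₀ r' v v' := by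
  induction L generalizing r u u' with
  | nil =>
    obtain rfl := Option.some_injective _ hv
    exact ⟨u, r, rfl, h⟩
  | cons i L ih =>
    obtain ⟨w', hw', hv⟩ := Option.bind_eq_some_iff.1 hv
    obtain ⟨w, hw, hS⟩ := h.swap.succ M.swap (hL i (by simp)) hw'
    obtain ⟨v, r', hv, hS⟩ := ih (fun k hk => hL k (by simp [hk])) hS.swap hv
    exact ⟨v, r', by simp [run, hw, hv], hS⟩

end ColorOps

theorem optIter_add {V : Type} (f : V → Option V) (j k : ℕ) (v : V) :
    optIter f (j + k) v = (optIter f j v).bind (optIter f k) := by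
  induction j generalizing v with
  | zero => simp [optIter]
  | succ j ih =>
    rw [Nat.add_right_comm]
    simp only [optIter, Option.bind_assoc]
    congr 1
    exact funext ih

theorem optIter_one {V : Type} (f : V → Option V) (v : V) : optIter f 1 v = f v := by
  simp [optIter]

theorem le_card_of_optIter {V : Type} [Finite V] {f : V → Option V}
    (hf : ∀ v k, 0 < k → optIter f k v ≠ some v) {k : ℕ} {v w : V}
    (h : optIter f k v = some w) : k ≤ Nat.card V := by
  have hex : ∀ j : Fin (k + 1), ∃ x, optIter f j v = some x := by
    intro j
    have hj : (j : ℕ) + (k - j) = k := by omega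
    rw [← hj, optIter_add] at h
    obtain ⟨x, hx, -⟩ := Option.bind_eq_some_iff.1 h
    exact ⟨x, hx⟩
  choose g hg using hex
  have key : ∀ a b : Fin (k + 1), a < b → g a ≠ g b := by
    intro a b hab he
    have hb := hg b
    have hsum : (a : ℕ) + (b - a) = b := by omega
    rw [← hsum, optIter_add, hg a, Option.bind_some, ← he] at hb
    exact hf _ _ (by omega) hb
  have hinj : Function.Injective g := by
    intro a b he
    by_contra hne
    rcases lt_or_gt_of_ne hne with hab | hab
    · exact key a b hab he
    · exact key b a hab he.symm
  have := Nat.card_le_card_of_injective g hinj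
  simp only [Nat.card_eq_fintype_card, Fintype.card_fin] at this
  omega

namespace PreGraph

variable {K : PreGraph} {I : Set ℕ} {i : ℕ} {u v : K.V}

theorem bddAbove_h (hK : IsColored K I) (i : ℕ) (v : K.V) :
    BddAbove {k | (optIter (K.F i) k v).isSome = true} := by
  have := hK.1
  refine ⟨Nat.card K.V, fun k hk => ?_⟩
  obtain ⟨w, hw⟩ := Option.isSome_iff_exists.1 hk
  exact le_card_of_optIter (hK.2.2.2 i) hw

theorem bddAbove_t (hK : IsColored K I) (i : ℕ) (v : K.V) :
    BddAbove {k | ∃ u, optIter (K.F i) k u = some v} := by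
  have := hK.1
  exact ⟨Nat.card K.V, fun k ⟨u, hu⟩ => le_card_of_optIter (hK.2.2.2 i) hu⟩

theorem optIter_h_isSome (hK : IsColored K I) (i : ℕ) (v : K.V) :
    (optIter (K.F i) (K.h i v) v).isSome = true :=
  Nat.sSup_mem (s := {k | (optIter (K.F i) k v).isSome = true}) ⟨0, rfl⟩ (bddAbove_h hK i v)

theorem exists_optIter_t (hK : IsColored K I) (i : ℕ) (v : K.V) :
    ∃ u, optIter (K.F i) (K.t i v) u = some v :=
  Nat.sSup_mem (s := {k | ∃ u, optIter (K.F i) k u = some v}) ⟨0, v, rfl⟩ (bddAbove_t hK i v)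

theorem exists_F_of_h_pos (hK : IsColored K I) (h : 0 < K.h i v) : ∃ w, K.F i v = some w := by
  have hs := optIter_h_isSome hK i v
  obtain ⟨m, hm⟩ := Nat.exists_eq_add_of_lt h
  rw [hm, show 0 + m + 1 = 1 + m by omega, optIter_add, optIter_one] at hs
  cases hF : K.F i v with
  | none => simp [hF] at hs
  | some w => exact ⟨w, rfl⟩

theorem exists_pred_of_t_pos (hK : IsColored K I) (h : 0 < K.t i v) : ∃ u, K.F i u = some v := by
  obtain ⟨u, hu⟩ := exists_optIter_t hK i v
  obtain ⟨m, hm⟩ := Nat.exists_eq_add_of_lt h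
  rw [hm, zero_add, optIter_add] at hu
  obtain ⟨w, -, hw⟩ := Option.bind_eq_some_iff.1 hu
  exact ⟨w, by rwa [optIter_one] at hw⟩

theorem h_eq_add_one (hK : IsColored K I) (hv : K.F i u = some v) : K.h i u = K.h i v + 1 := by
  apply le_antisymm
  · have hs := optIter_h_isSome hK i u
    rcases Nat.eq_zero_or_pos (K.h i u) with h0 | h0
    · omega
    · obtain ⟨m, hm⟩ := Nat.exists_eq_add_of_lt h0
      rw [hm, show 0 + m + 1 = 1 + m by omega, optIter_add, optIter_one, hv,
        Option.bind_some] at hs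
      have : m ≤ K.h i v := le_csSup (bddAbove_h hK i v) hs
      omega
  · apply le_csSup (bddAbove_h hK i u)
    rw [Set.mem_ofPred_eq, add_comm, optIter_add, optIter_one, hv, Option.bind_some]
    exact optIter_h_isSome hK i v

theorem t_eq_add_one (hK : IsColored K I) (hv : K.F i u = some v) : K.t i v = K.t i u + 1 := by
  apply le_antisymm
  · obtain ⟨w, hw⟩ := exists_optIter_t hK i v
    rcases Nat.eq_zero_or_pos (K.t i v) with h0 | h0
    · omega
    · obtain ⟨m, hm⟩ := Nat.exists_eq_add_of_lt h0
      rw [hm, zero_add, optIter_add] at hw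
      obtain ⟨x, hx, hxv⟩ := Option.bind_eq_some_iff.1 hw
      rw [optIter_one] at hxv
      obtain rfl := hK.2.2.1 i x u v hxv hv
      have : m ≤ K.t i x := le_csSup (bddAbove_t hK i x) ⟨w, hx⟩
      omega
  · apply le_csSup (bddAbove_t hK i v)
    obtain ⟨w, hw⟩ := exists_optIter_t hK i u
    exact ⟨w, by rw [optIter_add, hw, Option.bind_some, optIter_one, hv]⟩

theorem Finv_eq_some_iff (hK : IsColored K I) : K.Finv i v = some u ↔ K.F i u = some v := by
  unfold Finv
  split_ifs with h
  · rw [Option.some_inj]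
    exact ⟨fun he => he ▸ h.choose_spec, fun hu => hK.2.2.1 i _ _ _ h.choose_spec hu⟩
  · exact ⟨by simp, fun hu => absurd ⟨u, hu⟩ h⟩

/-- A colored graph with its string lengths. -/
noncomputable def ops (K : PreGraph) (hK : IsColored K I) : ColorOps K.V where
  F := K.F
  φ := K.h
  ε := K.t
  inj := hK.2.2.1 _ _ _ _
  exists_F := exists_F_of_h_pos hK
  exists_pred := exists_pred_of_t_pos hK
  φ_F := h_eq_add_one hK
  ε_F := t_eq_add_one hK

theorem ops_run (hK : IsColored K I) (L : List ℕ) (v : K.V) :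
    (K.ops hK).run L v = applyStr K L v := by
  induction L generalizing v with
  | nil => rfl
  | cons i L ih =>
    simp only [ColorOps.run, applyStr]
    congr 1
    exact funext ih

theorem neighborAx_ops (hK : IsCrystalOn K I) {i j : ℕ} (hi : i ∈ I) (hj : j ∈ I)
    (hij : Neighb i j) : (K.ops hK.1).NeighborAx i j where
  label := by
    intro u v huv
    have hne : i ≠ j := by rintro rfl; unfold Neighb at hij; omega
    have := (hK.2.2.1 i hi j hj hne).1 u v huv
    simp only [hij, if_true] at this
    simp only [ops]
    omega
  square_down := by
    intro u v v' h h' hl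
    obtain ⟨h1, h2⟩ := (hK.2.2.2.1 i hi j hj hij).1.1 u v v' h h' hl
    exact ⟨by simp only [ops]; omega, h2⟩
  square_up := by
    intro u u' v h h' hl
    simp only [ops] at hl
    exact (hK.2.2.2.1 i hi j hj hij).1.2 u u' v h h' (by omega)
  verma_down := by
    intro u v v' h h' hl hl'
    simp only [ops] at h h' hl hl' ⊢
    obtain ⟨w, h1, h2⟩ :=
      (hK.2.2.2.1 i hi j hj hij).2.1 u v v' h h' (by omega) (by omega)
    simp only [h, h', Option.bind_some, Option.bind_eq_some_iff] at h1 h2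
    obtain ⟨q, ⟨p, hp, hq⟩, hw⟩ := h1
    obtain ⟨q', ⟨p', hp', hq'⟩, hw'⟩ := h2
    exact ⟨p, q, p', q', w, hp, hq, hw, hp', hq', hw'⟩
  verma_up := by
    intro u u' v h h' hl hl'
    simp only [ops] at h h' hl hl' ⊢
    obtain ⟨w, h1, h2⟩ := (hK.2.2.2.1 i hi j hj hij).2.2 u u' v h h' hl hl'
    simp only [(Finv_eq_some_iff hK.1).2 h, (Finv_eq_some_iff hK.1).2 h', Option.bind_some,
      Option.bind_eq_some_iff, Finv_eq_some_iff hK.1] at h1 h2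
    obtain ⟨q, ⟨p, hp, hq⟩, hw⟩ := h1
    obtain ⟨q', ⟨p', hp', hq'⟩, hw'⟩ := h2
    exact ⟨p, q, p', q', w, hp, hq, hw, hp', hq', hw'⟩

theorem farAx_ops (hK : IsCrystalOn K I) {i j : ℕ} (hi : i ∈ I) (hj : j ∈ I)
    (hij : Far i j) : (K.ops hK.1).FarAx i j where
  const := by
    intro u v huv
    have hne : i ≠ j := by rintro rfl; unfold Far at hij; omega
    have hn : ¬ Neighb i j := by unfold Neighb; unfold Far at hij; omega
    have := (hK.2.2.1 i hi j hj hne).1 u v huv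
    simp only [hn, if_false] at this
    simp only [ops]
    omega
  square_down := by
    intro u v v' h h'
    simp only [ops] at h h' ⊢
    obtain ⟨w, h1, h2⟩ := hK.2.2.2.2 i hi j hj hij (K.F i) (by simp) (K.F j) (by simp) u
      (by simp [h]) (by simp [h'])
    exact ⟨w, by simpa [h] using h1, by simpa [h'] using h2⟩
  square_up := by
    intro u u' v h h'
    simp only [ops] at h h' ⊢
    have e := (Finv_eq_some_iff hK.1).2 h
    have e' := (Finv_eq_some_iff hK.1).2 h'
    obtain ⟨w, h1, h2⟩ := hK.2.2.2.2 i hi j hj hij (K.Finv i) (by simp) (K.Finv j) (by simp) v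
      (by simp [e]) (by simp [e'])
    rw [e, Option.bind_some, Finv_eq_some_iff hK.1] at h1
    rw [e', Option.bind_some, Finv_eq_some_iff hK.1] at h2
    exact ⟨w, h1, h2⟩

theorem localAx_ops (hK : IsCrystalOn K I) : (K.ops hK.1).LocalAx I :=
  ⟨fun _ hi _ hj => neighborAx_ops hK hi hj, fun _ hi _ hj => farAx_ops hK hi hj⟩

end PreGraph

namespace ColorOps

variable {V : Type} {C : ColorOps V} {i j : ℕ}

theorem run_replicate_succ {e : ℕ} {u v : V} :
    C.run (List.replicate (e + 1) i) u = some v ↔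
      ∃ w, C.F i u = some w ∧ C.run (List.replicate e i) w = some v := by
  rw [List.replicate_succ, run, Option.bind_eq_some_iff]

theorem run_inj {L : List ℕ} {u u' v : V} (h : C.run L u = some v) (h' : C.run L u' = some v) :
    u = u' := by
  induction L generalizing u u' with
  | nil => exact Option.some_injective _ (h.trans h'.symm)
  | cons i L ih =>
    obtain ⟨w, hw, h⟩ := Option.bind_eq_some_iff.1 h
    obtain ⟨w', hw', h'⟩ := Option.bind_eq_some_iff.1 h'
    obtain rfl := ih h h'
    exact C.inj hw hw'

theorem ε_run_replicate {e : ℕ} {u v : V} (h : C.run (List.replicate e i) u = some v) :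
    C.ε i v = C.ε i u + e ∧ C.φ i u = C.φ i v + e := by
  induction e generalizing u with
  | zero =>
    obtain rfl := Option.some_injective _ h
    simp
  | succ e ih =>
    obtain ⟨w, hw, h⟩ := run_replicate_succ.1 h
    have := ih h
    have := C.ε_F hw
    have := C.φ_F hw
    omega

theorem NeighborAx.run_replicate (N : C.NeighborAx i j) {e : ℕ} {u v : V}
    (h : C.run (List.replicate e i) u = some v) :
    C.φ j v + C.ε j u = C.φ j u + C.ε j v + e ∧ C.ε j v ≤ C.ε j u ∧ C.ε j u ≤ C.ε j v + e := by
  induction e generalizing u with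
  | zero =>
    obtain rfl := Option.some_injective _ h
    simp
  | succ e ih =>
    obtain ⟨w, hw, h⟩ := run_replicate_succ.1 h
    have := ih h
    have := N.label hw
    omega

theorem FarAx.run_replicate (N : C.FarAx i j) {e : ℕ} {u v : V}
    (h : C.run (List.replicate e i) u = some v) : C.φ j v = C.φ j u ∧ C.ε j v = C.ε j u := by
  induction e generalizing u with
  | zero =>
    obtain rfl := Option.some_injective _ h
    simp
  | succ e ih =>
    obtain ⟨w, hw, h⟩ := run_replicate_succ.1 h
    have := ih h
    have := N.const hw
    omega

theorem run_snoc {L : List ℕ} {u v w : V} (h : C.run L u = some v) (hw : C.F i v = some w) :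
    C.run (L ++ [i]) u = some w := by
  simp [run_append, h, run, hw]

/-- Every vertex lies on an `i`-string that starts at a vertex with `ε i = 0`. -/
theorem exists_top (C : ColorOps V) (i : ℕ) (u : V) :
    ∃ y e, C.run (List.replicate e i) y = some u ∧ C.ε i y = 0 := by
  induction h : C.ε i u generalizing u with
  | zero => exact ⟨u, 0, rfl, h⟩
  | succ e ih =>
    obtain ⟨w, hw⟩ := C.exists_pred (i := i) (v := u) (by omega)
    have := C.ε_F hw
    obtain ⟨y, e', hy, hy'⟩ := ih w (by omega)
    exact ⟨y, e' + 1, by rw [List.replicate_succ']; exact run_snoc hy hw, hy'⟩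

/-- All edges of the `i`-string ending at the given vertex have label `1` with respect to `j`. -/
inductive StraightTo (C : ColorOps V) (i j : ℕ) : V → Prop
  | top {b} : C.ε i b = 0 → StraightTo C i j b
  | edge {p b} : C.F i p = some b → C.φ j b = C.φ j p + 1 → StraightTo C i j p →
      StraightTo C i j b

theorem StraightTo.exists_top (N : C.NeighborAx i j) {b : V} (h : C.StraightTo i j b) :
    ∃ z e, C.run (List.replicate e i) z = some b ∧ C.ε i z = 0 ∧ C.ε j z = C.ε j b := by
  induction h with
  | @top b h => exact ⟨b, 0, rfl, h, rfl⟩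
  | edge hp hl _ ih =>
    obtain ⟨z, e, h1, h2, h3⟩ := ih
    have := N.label hp
    exact ⟨z, e + 1, by rw [List.replicate_succ']; exact run_snoc h1 hp, h2, by omega⟩

theorem StraightTo.pred (N : C.NeighborAx i j) (N' : C.NeighborAx j i) {b b' : V}
    (h : C.StraightTo i j b) (hb : C.F j b' = some b) (hl : C.φ i b = C.φ i b') :
    C.StraightTo i j b' := by
  induction h generalizing b' with
  | @top b h =>
    have hlab := N'.label hb
    obtain ⟨w, hw⟩ := C.exists_pred (i := i) (v := b') (by omega)
    have hε := C.ε_F hw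
    refine .edge hw ?_ (.top (by omega))
    rcases N.label hw with ⟨h1, -⟩ | ⟨h1, -⟩
    · exact h1
    · have := C.φ_F hb
      obtain ⟨y, hy⟩ := C.exists_F (i := j) (u := w) (by omega)
      obtain ⟨-, z, hz, hz'⟩ := N.square_down hw hy h1
      obtain rfl := Option.some_injective _ (hb.symm.trans hz)
      have := C.ε_F hz'
      omega
  | @edge p b hp hpl _ ih =>
    obtain ⟨-, w, hw, hw'⟩ := N.square_up hp hb hpl
    have := C.φ_F hw
    have := C.φ_F hw'
    have := C.φ_F hb
    have := C.φ_F hp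
    exact .edge hw' (by omega) (ih hw (by omega))

/-- Labels with respect to `j` do not decrease along `i`-strings. -/
def Convex (C : ColorOps V) (i j : ℕ) : Prop :=
  ∀ u v w, C.F i u = some v → C.F i v = some w → 2 * C.φ j v ≤ C.φ j u + C.φ j w

theorem straightTo_of_run (N : C.NeighborAx i j) (N' : C.NeighborAx j i) (hc : C.Convex j i)
    {e : ℕ} {x y : V} (h : C.run (List.replicate e j) y = some x) (hx : C.ε i x = 0) :
    C.StraightTo i j y := by
  suffices C.StraightTo i j y ∧ (C.ε i y = 0 ∨ ∃ w, C.F j y = some w ∧ C.φ i w = C.φ i y) from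
    this.1
  induction e generalizing y with
  | zero =>
    obtain rfl := Option.some_injective _ h
    exact ⟨.top hx, .inl hx⟩
  | succ e ih =>
    obtain ⟨w, hw, h⟩ := run_replicate_succ.1 h
    obtain ⟨h1, h2⟩ := ih h
    rcases N'.label hw with ⟨h3, h4⟩ | ⟨h3, h4⟩
    · rcases h2 with h2 | ⟨w', hw', h2⟩
      · exact ⟨.top (by omega), .inl (by omega)⟩
      · have := hc _ _ _ hw hw'
        omega
    · exact ⟨h1.pred N N' hw h3, .inr ⟨w, hw, h3⟩⟩

/-- The string that applies the color `σ k` exactly `b 1 + ⋯ + b k` times, for `k = 1, …, m`. -/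
def stair (σ b : ℕ → ℕ) (m : ℕ) : List ℕ :=
  (List.range m).flatMap fun k => List.replicate (∑ l ∈ Finset.range (k + 1), b (l + 1)) (σ (k + 1))

theorem stair_succ (σ b : ℕ → ℕ) (m : ℕ) : stair σ b (m + 1) =
    stair σ b m ++ List.replicate (∑ l ∈ Finset.range (m + 1), b (l + 1)) (σ (m + 1)) := by
  simp [stair, List.range_succ]

theorem stair_congr {σ b b' : ℕ → ℕ} {m : ℕ} (h : ∀ k, 1 ≤ k → k ≤ m → b k = b' k) :
    stair σ b m = stair σ b' m := by
  induction m with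
  | zero => rfl
  | succ m ih =>
    rw [stair_succ, stair_succ, ih fun k h1 h2 => h k h1 (by omega)]
    congr 2
    exact Finset.sum_congr rfl fun l hl => h _ (by omega) (by rw [Finset.mem_range] at hl; omega)

/-- `σ` enumerates the colors in `I` along the Dynkin diagram of type `A`, from one of its ends
to the other. -/
structure Enumerates (σ : ℕ → ℕ) (I : Set ℕ) (n : ℕ) : Prop where
  mem : ∀ {k}, 1 ≤ k → k ≤ n → σ k ∈ I
  neighb : ∀ {k}, 1 ≤ k → k + 1 ≤ n → Neighb (σ k) (σ (k + 1))
  far : ∀ {k l}, 1 ≤ k → k + 2 ≤ l → l ≤ n → Far (σ k) (σ l)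

variable {σ : ℕ → ℕ} {I : Set ℕ} {n : ℕ} {s : V}

theorem exists_stair_aux (hσ : Enumerates σ I n) (hC : C.LocalAx I)
    (hconv : ∀ i ∈ I, ∀ j ∈ I, Neighb i j → C.Convex i j)
    (hs : ∀ u, (∀ k, 1 ≤ k → k ≤ n → C.ε (σ k) u = 0) → u = s) (m : ℕ) (hm : m ≤ n) (u : V)
    (hu : ∀ k, 1 ≤ k → k ≤ n → k ≠ m → C.ε (σ k) u = 0)
    (htop : 1 ≤ m → ∃ y e, C.run (List.replicate e (σ m)) y = some u ∧ C.ε (σ m) y = 0 ∧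
      (m < n → C.ε (σ (m + 1)) y = 0)) :
    ∃ b : ℕ → ℕ, (∀ k, 1 ≤ k → k ≤ m → b k ≤ C.φ (σ k) s) ∧ C.run (stair σ b m) s = some u ∧
      (1 ≤ m → C.ε (σ m) u = ∑ l ∈ Finset.range m, b (l + 1)) ∧
      (m + 1 ≤ n → C.φ (σ (m + 1)) u = C.φ (σ (m + 1)) s + ∑ l ∈ Finset.range m, b (l + 1)) ∧
      ∀ k, m + 2 ≤ k → k ≤ n → C.φ (σ k) u = C.φ (σ k) s := by
  induction m generalizing u with
  | zero =>
    obtain rfl := hs u fun k h1 h2 => hu k h1 h2 (by omega)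
    exact ⟨fun _ => 0, fun _ _ _ => Nat.zero_le _, rfl, by simp, by simp, fun _ _ _ => rfl⟩
  | succ m ih =>
    obtain ⟨y, e, hy, hy0, hy1⟩ := htop (by omega)
    have memm := hσ.mem (k := m + 1) (by omega) hm
    have hfar : ∀ k, 1 ≤ k → k ≤ n → k + 2 ≤ m + 1 ∨ m + 3 ≤ k → C.FarAx (σ (m + 1)) (σ k) := by
      intro k h1 h2 h3
      refine hC.2 _ memm _ (hσ.mem h1 h2) ?_
      rcases h3 with h3 | h3
      · exact (hσ.far h1 h3 hm).symm
      · exact hσ.far (by omega) h3 h2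
    have hNp : 1 ≤ m → C.NeighborAx (σ m) (σ (m + 1)) ∧ C.NeighborAx (σ (m + 1)) (σ m) :=
      fun h1 => ⟨hC.1 _ (hσ.mem h1 (by omega)) _ memm (hσ.neighb h1 hm),
        hC.1 _ memm _ (hσ.mem h1 (by omega)) (hσ.neighb h1 hm).symm⟩
    obtain ⟨b, hb, hrun, hε, hφ, hφ'⟩ := ih (by omega) y
      (by
        intro k h1 h2 h3
        by_cases h4 : k = m + 1
        · rw [h4, hy0]
        by_cases h5 : k = m + 2
        · rw [h5, hy1 (by omega)]
        · rw [← ((hfar k h1 h2 (by omega)).run_replicate hy).2]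
          exact hu k h1 h2 (by omega))
      (by
        intro h1
        obtain ⟨N, N'⟩ := hNp h1
        obtain ⟨z, e', hz1, hz2, hz3⟩ := (straightTo_of_run N N'
          (hconv _ memm _ (hσ.mem h1 (by omega)) (hσ.neighb h1 hm).symm) hy
          (hu m h1 (by omega) (by omega))).exists_top N
        exact ⟨z, e', hz1, hz2, fun _ => by rw [hz3, hy0]⟩)
    set B := ∑ l ∈ Finset.range m, b (l + 1) with hB
    have hBe : B ≤ e := by
      rcases Nat.eq_zero_or_pos m with rfl | h1
      · simp [hB]
      · have := (hNp h1).2.run_replicate hy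
        have := hu m h1 (by omega) (by omega)
        have := hε h1
        omega
    have heφ := (ε_run_replicate hy)
    have hφm := hφ hm
    have hb' : ∀ k, k ≤ m → Function.update b (m + 1) (e - B) k = b k := by
      intro k hk
      rw [Function.update_of_ne (by omega)]
    have hsum : ∑ l ∈ Finset.range (m + 1), Function.update b (m + 1) (e - B) (l + 1) = e := by
      rw [Finset.sum_range_succ, Function.update_self, Finset.sum_congr rfl fun l hl =>
        hb' (l + 1) (by rw [Finset.mem_range] at hl; omega), ← hB]
      omega
    refine ⟨Function.update b (m + 1) (e - B), ?_, ?_, ?_, ?_, ?_⟩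
    · intro k h1 h2
      rcases Nat.lt_or_eq_of_le h2 with h2 | rfl
      · rw [hb' k (by omega)]
        exact hb k h1 (by omega)
      · rw [Function.update_self]
        omega
    · rw [stair_succ, stair_congr fun k _ h2 => hb' k h2, run_append, hrun, hsum]
      exact hy
    · intro _
      rw [hsum]
      omega
    · intro h1
      have hN := hC.1 _ memm _ (hσ.mem (by omega) h1) (hσ.neighb (by omega) h1)
      have := hN.run_replicate hy
      have := hy1 (by omega)
      have := hu (m + 1 + 1) (by omega) h1 (by omega)
      have := hφ' (m + 1 + 1) (by omega) h1
      rw [hsum]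
      omega
    · intro k h1 h2
      rw [((hfar k (by omega) h2 (by omega)).run_replicate hy).1]
      exact hφ' k (by omega) h2

/-- A vertex that is a source for all colors but the last one is reached from the source by a
staircase string. -/
theorem exists_stair (hσ : Enumerates σ I n) (hC : C.LocalAx I)
    (hconv : ∀ i ∈ I, ∀ j ∈ I, Neighb i j → C.Convex i j)
    (hs : ∀ u, (∀ k, 1 ≤ k → k ≤ n → C.ε (σ k) u = 0) → u = s) {u : V}
    (hu : ∀ k, 1 ≤ k → k < n → C.ε (σ k) u = 0) :
    ∃ b : ℕ → ℕ, (∀ k, 1 ≤ k → k ≤ n → b k ≤ C.φ (σ k) s) ∧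
      C.run (stair σ b n) s = some u := by
  obtain ⟨b, h1, h2, -⟩ := exists_stair_aux hσ hC hconv hs n le_rfl u
    (fun k h1 h2 h3 => hu k h1 (by omega)) (fun _ => by
      obtain ⟨y, e, h1, h2⟩ := C.exists_top (σ n) u
      exact ⟨y, e, h1, h2, by simp⟩)
  exact ⟨b, h1, h2⟩

theorem ε_run_eq_zero (hC : C.LocalAx I) {L : List ℕ} {j : ℕ} (hj : j ∈ I)
    (hL : ∀ i ∈ L, i ∈ I ∧ i ≠ j) {u v : V} (hu : C.ε j u = 0) (h : C.run L u = some v) :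
    C.ε j v = 0 := by
  induction L generalizing u with
  | nil =>
    obtain rfl := Option.some_injective _ h
    exact hu
  | cons i L ih =>
    obtain ⟨w, hw, h⟩ := Option.bind_eq_some_iff.1 h
    obtain ⟨hi, hij⟩ := hL i (by simp)
    refine ih (fun k hk => hL k (by simp [hk])) ?_ h
    rcases eq_or_neighb_or_far i j with rfl | hN | hF
    · exact absurd rfl hij
    · have := (hC.1 i hi j hj hN).label hw
      omega
    · rw [((hC.2 i hi j hj hF).const hw).2, hu]

theorem mem_stair {σ b : ℕ → ℕ} {m i : ℕ} (h : i ∈ stair σ b m) :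
    ∃ k, 1 ≤ k ∧ k ≤ m ∧ i = σ k := by
  simp only [stair, List.mem_flatMap, List.mem_range, List.mem_replicate] at h
  obtain ⟨k, hk, -, rfl⟩ := h
  exact ⟨k + 1, by omega, by omega, rfl⟩

theorem stair_injective (hσ : Enumerates σ I n) (hC : C.LocalAx I)
    (hs : ∀ k, 1 ≤ k → k ≤ n → C.ε (σ k) s = 0) {b b' : ℕ → ℕ} {m : ℕ} (hm : m ≤ n) {u : V}
    (h : C.run (stair σ b m) s = some u) (h' : C.run (stair σ b' m) s = some u) :
    ∀ k, 1 ≤ k → k ≤ m → b k = b' k := by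
  induction m generalizing u with
  | zero => omega
  | succ m ih =>
    rw [stair_succ, run_append] at h h'
    obtain ⟨y, hy, hyu⟩ := Option.bind_eq_some_iff.1 h
    obtain ⟨y', hy', hyu'⟩ := Option.bind_eq_some_iff.1 h'
    have hmem : ∀ b : ℕ → ℕ, ∀ i ∈ stair σ b m, i ∈ I ∧ i ≠ σ (m + 1) := by
      intro b i hi
      obtain ⟨k, h1, h2, rfl⟩ := mem_stair hi
      refine ⟨hσ.mem h1 (by omega), fun he => ?_⟩
      rcases Nat.lt_or_eq_of_le h2 with h3 | rfl
      · have := hσ.far h1 (show k + 2 ≤ m + 1 by omega) hm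
        unfold Far at this
        omega
      · have := hσ.neighb h1 hm
        unfold Neighb at this
        omega
    have memm := hσ.mem (show 1 ≤ m + 1 by omega) hm
    have hsm := hs (m + 1) (by omega) hm
    have e1 := ε_run_eq_zero hC memm (hmem b) hsm hy
    have e2 := ε_run_eq_zero hC memm (hmem b') hsm hy'
    have e3 := (ε_run_replicate hyu).1
    have e4 := (ε_run_replicate hyu').1
    have hsum : ∑ l ∈ Finset.range (m + 1), b (l + 1) = ∑ l ∈ Finset.range (m + 1), b' (l + 1) := by
      omega
    rw [hsum] at hyu
    obtain rfl := run_inj hyu hyu'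
    have hih := ih (by omega) hy hy'
    intro k h1 h2
    rcases Nat.lt_or_eq_of_le h2 with h3 | rfl
    · exact hih k h1 (by omega)
    · rw [Finset.sum_range_succ, Finset.sum_range_succ, Finset.sum_congr rfl fun l hl =>
        hih (l + 1) (by omega) (by rw [Finset.mem_range] at hl; omega)] at hsum
      omega

end ColorOps

/-! ### Words -/

namespace Word

/-- The length of the `i`-string starting at a word; the head of the list is its last letter. -/
def φ (i : ℕ) : List ℕ → ℕ
  | [] => 0
  | c :: b => (if c = i then 1 else 0) + (φ i b - if c = i + 1 then 1 else 0)

/-- The length of the `i`-string ending at a word. -/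
def ε (i : ℕ) : List ℕ → ℕ
  | [] => 0
  | c :: b => ε i b + ((if c = i + 1 then 1 else 0) - φ i b)

/-- The crystal operators on words, given by the signature rule. -/
def F (i : ℕ) : List ℕ → Option (List ℕ)
  | [] => none
  | c :: b =>
    if c = i ∧ φ i b = 0 then some ((i + 1) :: b)
    else if c = i + 1 ∧ φ i b ≤ 1 then none
    else (F i b).map (c :: ·)

/-- Apply a string of operators to a word, head first. -/
def run : List ℕ → List ℕ → Option (List ℕ)
  | [], w => some w
  | i :: L, w => (F i w).bind (run L)

theorem run_append (L L' w : List ℕ) : run (L ++ L') w = (run L w).bind (run L') := by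
  induction L generalizing w with
  | nil => rfl
  | cons i L ih =>
    simp only [List.cons_append, run, Option.bind_assoc]
    congr 1
    exact funext ih

/-- The operators with no edges on a one-element type. -/
def trivialOps : ColorOps Unit where
  F _ _ := none
  φ _ _ := 0
  ε _ _ := 0
  inj := by simp
  exists_F := by simp
  exists_pred := by simp
  φ_F := by simp
  ε_F := by simp

/-- Every word belongs to a crystal satisfying the local axioms. -/
theorem exists_model (w : List ℕ) : ∃ (V : Type) (C : ColorOps V) (f : V → List ℕ) (b : V),
    C.LocalAx Set.univ ∧ Function.Injective f ∧ f b = w ∧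
    (∀ i v, F i (f v) = (C.F i v).map f) ∧ (∀ i v, φ i (f v) = C.φ i v) ∧
    ∀ i v, ε i (f v) = C.ε i v := by
  induction w with
  | nil =>
    refine ⟨Unit, trivialOps, fun _ => [], (), ⟨fun i _ j _ _ => ?_, fun i _ j _ _ => ?_⟩,
      fun _ _ _ => rfl, rfl, fun _ _ => rfl, fun _ _ => rfl, fun _ _ => rfl⟩ <;>
      constructor <;> simp [trivialOps]
  | cons c w ih =>
    obtain ⟨V, C, f, b, hC, hf, rfl, hF, hφ, hε⟩ := ih
    refine ⟨V × ℕ, C.snoc, fun v => v.2 :: f v.1, (b, c), hC.snoc, ?_, rfl, ?_, ?_, ?_⟩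
    · rintro ⟨v, c⟩ ⟨v', c'⟩ h
      simp only [List.cons.injEq] at h
      rw [h.1, hf h.2]
    · rintro i ⟨v, c⟩
      simp only [F, ColorOps.snoc, ColorOps.snocF, hφ, hF]
      split_ifs <;> simp [Function.comp_def]
    · rintro i ⟨v, c⟩
      simp only [φ, hφ, ColorOps.snoc]
    · rintro i ⟨v, c⟩
      simp only [ε, hφ, hε, ColorOps.snoc]

theorem φ_append (i : ℕ) (q p : List ℕ) : φ i (q ++ p) = φ i q + (φ i p - ε i q) := by
  induction q with
  | nil => simp [φ, ε]
  | cons c q ih =>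
    simp only [List.cons_append, φ, ε, ih]
    split_ifs <;> omega

theorem ε_append (i : ℕ) (q p : List ℕ) : ε i (q ++ p) = ε i p + (ε i q - φ i p) := by
  induction q with
  | nil => simp [ε]
  | cons c q ih =>
    simp only [List.cons_append, ε, ih, φ_append]
    split_ifs <;> omega

theorem φ_append_eq_zero {i : ℕ} {q p : List ℕ} (hq : φ i q = 0) (hp : φ i p = 0) :
    φ i (q ++ p) = 0 := by
  simp [φ_append, hq, hp]

theorem ε_append_eq_zero {i : ℕ} {q p : List ℕ} (hq : ε i q = 0) (hp : ε i p = 0) :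
    ε i (q ++ p) = 0 := by
  simp [ε_append, hq, hp]

theorem F_eq_none {i : ℕ} {w : List ℕ} (h : φ i w = 0) : F i w = none := by
  induction w with
  | nil => rfl
  | cons c w ih =>
    simp only [φ, F] at h ⊢
    split_ifs at h ⊢ with h1 h2 <;> grind

theorem F_append_left {i : ℕ} {q q' p : List ℕ} (hp : φ i p = 0) (h : F i q = some q') :
    F i (q ++ p) = some (q' ++ p) := by
  have key : F i (q ++ p) = (F i q).map (· ++ p) := by
    clear h
    induction q with
    | nil => simp [F, F_eq_none hp]
    | cons c q ih =>
      simp only [List.cons_append, F, ih, φ_append, hp]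
      split_ifs <;> simp_all [Function.comp_def]
  simp [key, h]

theorem F_append_right {i : ℕ} {q p p' : List ℕ} (hq : ε i q = 0) (h : F i p = some p') :
    F i (q ++ p) = some (q ++ p') := by
  have hp : φ i p ≠ 0 := fun h0 => by simp [F_eq_none h0] at h
  induction q with
  | nil => exact h
  | cons c q ih =>
    simp only [ε] at hq
    simp only [List.cons_append, F, ih (by omega), φ_append]
    split_ifs at hq ⊢ <;> first | rfl | grind

theorem run_append_right {L q p p' : List ℕ} (hq : ∀ i ∈ L, ε i q = 0) (h : run L p = some p') :
    run L (q ++ p) = some (q ++ p') := by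
  induction L generalizing p with
  | nil => simp_all [run]
  | cons i L ih =>
    obtain ⟨m, hm, h⟩ := Option.bind_eq_some_iff.1 h
    rw [run, F_append_right (hq i (by simp)) hm, Option.bind_some]
    exact ih (fun k hk => hq k (by simp [hk])) h

theorem run_append_left {L q q' p : List ℕ} (hp : ∀ i ∈ L, φ i p = 0) (h : run L q = some q') :
    run L (q ++ p) = some (q' ++ p) := by
  induction L generalizing q with
  | nil => simp_all [run]
  | cons i L ih =>
    obtain ⟨m, hm, h⟩ := Option.bind_eq_some_iff.1 h
    rw [run, F_append_left (hp i (by simp)) hm, Option.bind_some]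
    exact ih (fun k hk => hp k (by simp [hk])) h

theorem run_cons {L w w' : List ℕ} {c : ℕ} (hc : ∀ i ∈ L, c ≠ i + 1) (h : run L w = some w') :
    run L (c :: w) = some (c :: w') :=
  run_append_right (q := [c]) (fun i hi => by simp [ε, φ, hc i hi]) h

/-! ### Columns -/

/-- The column with entries `j, …, j + k - 1`, largest entry at the head. -/
def col (j : ℕ) : ℕ → List ℕ
  | 0 => []
  | k + 1 => (j + k) :: col j k

theorem φ_col (i j k : ℕ) : φ i (col j k) = if i + 1 = j + k ∧ 0 < k then 1 else 0 := by
  induction k with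
  | zero => simp [col, φ]
  | succ k ih =>
    simp only [col, φ, ih]
    split_ifs <;> omega

theorem ε_col (i j k : ℕ) : ε i (col j k) = if i + 1 = j ∧ 0 < k then 1 else 0 := by
  induction k with
  | zero => simp [col, ε]
  | succ k ih =>
    simp only [col, ε, ih, φ_col]
    split_ifs <;> omega

theorem col_succ_append (j k : ℕ) : col (j + 1) k ++ [j] = col j (k + 1) := by
  induction k with
  | zero => rfl
  | succ k ih =>
    rw [col, List.cons_append, ih, col]
    congr 1
    omega

theorem wStr_succ (k j : ℕ) : wStr 0 (k + 1) j = (j + k) :: wStr 0 k j := by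
  simp only [wStr, List.range_succ_eq_map, List.map_cons, List.map_map]
  refine congrArg₂ _ (by omega) (List.map_congr_left fun m _ => ?_)
  simp only [Function.comp]
  omega

theorem mem_wStr {k j i : ℕ} (h : i ∈ wStr 0 k j) : j ≤ i ∧ i + 1 ≤ j + k := by
  simp only [wStr, List.mem_map, List.mem_range] at h
  omega

theorem run_wStr (k j : ℕ) : run (wStr 0 k j) (col j k) = some (col (j + 1) k) := by
  induction k with
  | zero => rfl
  | succ k ih =>
    have h : φ (j + k) (col j k) = 0 := by
      rw [φ_col, if_neg (by omega)]
    rw [wStr_succ, run, col, F, if_pos ⟨rfl, h⟩, Option.bind_some, col,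
      run_cons (fun i hi => ?_) ih]
    · congr 2
      omega
    · have := mem_wStr hi
      omega

theorem run_flatMap_wStr (k j r : ℕ) :
    run ((List.range r).flatMap fun m => wStr 0 k (m + j)) (col j k) = some (col (j + r) k) := by
  induction r with
  | zero => rfl
  | succ r ih =>
    rw [List.range_succ, List.flatMap_append, run_append, ih]
    simp only [List.flatMap_cons, List.flatMap_nil, List.append_nil, Option.bind_some]
    rw [add_comm r j, run_wStr]
    rfl

theorem mem_flatMap_wStr {k j r i : ℕ}
    (h : i ∈ (List.range r).flatMap fun m => wStr 0 k (m + j)) :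
    j ≤ i ∧ i + 2 ≤ j + k + r := by
  simp only [List.mem_flatMap, List.mem_range] at h
  obtain ⟨m, hm, h⟩ := h
  have := mem_wStr h
  omega

/-! ### Words composed of blocks -/

/-- The word made of `a k` copies of `X k` for each `k ≤ m`, in the order of decreasing `k`. -/
def blk (X : ℕ → List ℕ) (a : ℕ → ℕ) : ℕ → List ℕ
  | 0 => []
  | m + 1 => (List.replicate (a (m + 1)) (X (m + 1))).flatten ++ blk X a m

theorem φ_flatten_replicate_eq_zero {i : ℕ} {w : List ℕ} (h : φ i w = 0) (r : ℕ) :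
    φ i (List.replicate r w).flatten = 0 := by
  induction r with
  | zero => rfl
  | succ r ih =>
    rw [List.replicate_succ, List.flatten_cons]
    exact φ_append_eq_zero h ih

theorem ε_flatten_replicate_eq_zero {i : ℕ} {w : List ℕ} (h : ε i w = 0) (r : ℕ) :
    ε i (List.replicate r w).flatten = 0 := by
  induction r with
  | zero => rfl
  | succ r ih =>
    rw [List.replicate_succ, List.flatten_cons]
    exact ε_append_eq_zero h ih

theorem φ_blk_eq_zero {i m : ℕ} {X : ℕ → List ℕ} {a : ℕ → ℕ}
    (h : ∀ k, 1 ≤ k → k ≤ m → φ i (X k) = 0) : φ i (blk X a m) = 0 := by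
  induction m with
  | zero => rfl
  | succ m ih =>
    exact φ_append_eq_zero (φ_flatten_replicate_eq_zero (h _ (by omega) le_rfl) _)
      (ih fun k h1 h2 => h k h1 (by omega))

theorem ε_blk_eq_zero {i m : ℕ} {X : ℕ → List ℕ} {a : ℕ → ℕ}
    (h : ∀ k, 1 ≤ k → k ≤ m → ε i (X k) = 0) : ε i (blk X a m) = 0 := by
  induction m with
  | zero => rfl
  | succ m ih =>
    exact ε_append_eq_zero (ε_flatten_replicate_eq_zero (h _ (by omega) le_rfl) _)
      (ih fun k h1 h2 => h k h1 (by omega))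

theorem blk_congr {X Y : ℕ → List ℕ} {a : ℕ → ℕ} {m : ℕ}
    (h : ∀ k, 1 ≤ k → k ≤ m → X k = Y k) : blk X a m = blk Y a m := by
  induction m with
  | zero => rfl
  | succ m ih =>
    rw [blk, blk, ih fun k h1 h2 => h k h1 (by omega), h (m + 1) (by omega) le_rfl]

theorem run_flatten_replicate {T q p X Y : List ℕ} (hT : run T X = some Y)
    (hq : ∀ i ∈ T, ε i q = 0) (hX : ∀ i ∈ T, ε i X = 0) (hp : ∀ i ∈ T, φ i p = 0)
    (hY : ∀ i ∈ T, φ i Y = 0) (r : ℕ) :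
    run (List.replicate r T).flatten (q ++ ((List.replicate r X).flatten ++ p)) =
      some (q ++ ((List.replicate r Y).flatten ++ p)) := by
  induction r generalizing q with
  | zero => rfl
  | succ r ih =>
    have h1 := ih (q := q ++ X) fun i hi => ε_append_eq_zero (hq i hi) (hX i hi)
    rw [List.replicate_succ' (a := T), List.flatten_concat, run_append, List.replicate_succ,
      List.flatten_cons, List.append_assoc, ← List.append_assoc, h1, Option.bind_some,
      List.append_assoc, List.replicate_succ, List.flatten_cons, List.append_assoc]
    exact run_append_right hq (run_append_left
      (fun i hi => φ_append_eq_zero (φ_flatten_replicate_eq_zero (hY i hi) _) (hp i hi)) hT)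

/-- The string that applies `T k` exactly `a k` times, for `k = 1, …, m`. -/
def blkStr (T : ℕ → List ℕ) (a : ℕ → ℕ) (m : ℕ) : List ℕ :=
  (List.range m).flatMap fun k => (List.replicate (a (k + 1)) (T (k + 1))).flatten

theorem run_blkStr {T X Y : ℕ → List ℕ} {a : ℕ → ℕ} {I : Set ℕ} {q : List ℕ} {m : ℕ}
    (hI : ∀ k, 1 ≤ k → k ≤ m → ∀ i ∈ T k, i ∈ I)
    (hT : ∀ k, 1 ≤ k → k ≤ m → run (T k) (X k) = some (Y k))
    (hX : ∀ k, 1 ≤ k → k ≤ m → ∀ i ∈ I, ε i (X k) = 0)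
    (hY : ∀ k, 1 ≤ k → k ≤ m → ∀ i ∈ I, φ i (Y k) = 0) (hq : ∀ i ∈ I, ε i q = 0) :
    run (blkStr T a m) (q ++ blk X a m) = some (q ++ blk Y a m) := by
  induction m generalizing q with
  | zero => rfl
  | succ m ih =>
    have hm := hI (m + 1) (by omega) le_rfl
    have hXm := hX (m + 1) (by omega) le_rfl
    have h1 := ih (q := q ++ (List.replicate (a (m + 1)) (X (m + 1))).flatten)
      (fun k h1 h2 => hI k h1 (by omega)) (fun k h1 h2 => hT k h1 (by omega))
      (fun k h1 h2 => hX k h1 (by omega)) (fun k h1 h2 => hY k h1 (by omega))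
      fun i hi => ε_append_eq_zero (hq i hi) (ε_flatten_replicate_eq_zero (hXm i hi) _)
    have h2 : blkStr T a (m + 1) =
        blkStr T a m ++ (List.replicate (a (m + 1)) (T (m + 1))).flatten := by
      simp [blkStr, List.range_succ]
    rw [h2, run_append, blk, ← List.append_assoc, h1, Option.bind_some, List.append_assoc, blk]
    exact run_flatten_replicate (hT _ (by omega) le_rfl) (fun i hi => hq i (hm i hi))
      (fun i hi => hXm i (hm i hi))
      (fun i hi => φ_blk_eq_zero fun k h1 h2 => hY k h1 (by omega) i (hm i hi))
      (fun i hi => hY _ (by omega) le_rfl i (hm i hi)) _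

theorem mem_blkStr {T : ℕ → List ℕ} {a : ℕ → ℕ} {m i : ℕ} (h : i ∈ blkStr T a m) :
    ∃ k, 1 ≤ k ∧ k ≤ m ∧ i ∈ T k := by
  simp only [blkStr, List.mem_flatMap, List.mem_range, List.mem_flatten, List.mem_replicate] at h
  obtain ⟨k, hk, l, ⟨-, rfl⟩, hl⟩ := h
  exact ⟨k + 1, by omega, by omega, hl⟩

end Word

open ColorOps (stair stair_succ)

namespace Word

theorem run_stair {σ a b : ℕ → ℕ} {X : ℕ → ℕ → List ℕ} {P : ℕ → ℕ → Prop}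
    [∀ m k, Decidable (P m k)] {q : List ℕ} {n : ℕ}
    (hF : ∀ m k, m < n → 1 ≤ k → k ≤ n → P m k → F (σ (m + 1)) (X m k) = some (X (m + 1) k))
    (hE : ∀ m k, m < n → 1 ≤ k → k ≤ n → ¬ P m k → X m k = X (m + 1) k)
    (hε : ∀ m k, m < n → 1 ≤ k → k ≤ n → ε (σ (m + 1)) (X m k) = 0)
    (hφ : ∀ m k, m < n → 1 ≤ k → k ≤ n → φ (σ (m + 1)) (X (m + 1) k) = 0)
    (hq : ∀ i, 1 ≤ i → ε i q = 0) (hσ : ∀ m, m < n → 1 ≤ σ (m + 1))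
    (hsum : ∀ m, m < n → ∑ k ∈ Finset.range n, (if P m (k + 1) then a (k + 1) else 0) =
      ∑ l ∈ Finset.range (m + 1), b (l + 1)) {m : ℕ} (hm : m ≤ n) :
    run (stair σ b m) (q ++ blk (X 0) a n) = some (q ++ blk (X m) a n) := by
  induction m with
  | zero => rfl
  | succ m ih =>
    have hstr : ∀ N, blkStr (fun k => if P m k then [σ (m + 1)] else []) a N =
        List.replicate (∑ k ∈ Finset.range N, if P m (k + 1) then a (k + 1) else 0)
          (σ (m + 1)) := by
      intro N
      induction N with
      | zero => rfl
      | succ N ih =>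
        rw [Finset.sum_range_succ, List.replicate_add, ← ih]
        simp only [blkStr, List.range_succ, List.flatMap_append, List.flatMap_cons,
          List.flatMap_nil, List.append_nil]
        congr 1
        split_ifs <;> simp
    rw [stair_succ, run_append, ih (by omega), Option.bind_some, ← hsum m hm, ← hstr]
    refine run_blkStr (I := {σ (m + 1)}) (fun k _ _ i hi => ?_) (fun k h1 h2 => ?_)
      (fun k h1 h2 i hi => ?_) (fun k h1 h2 i hi => ?_) (fun i hi => ?_)
    · split_ifs at hi
      · simpa using hi
      · simp at hi
    · split_ifs with h
      · rw [run, hF m k hm h1 h2 h, Option.bind_some, run]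
      · rw [run, hE m k hm h1 h2 h]
    · obtain rfl := Set.mem_singleton_iff.1 hi
      exact hε m k hm h1 h2
    · obtain rfl := Set.mem_singleton_iff.1 hi
      exact hφ m k hm h1 h2
    · obtain rfl := Set.mem_singleton_iff.1 hi
      exact hq _ (hσ m hm)

theorem ε_blk_col {i : ℕ} (hi : 1 ≤ i) (a : ℕ → ℕ) (m : ℕ) : ε i (blk (col 1) a m) = 0 :=
  ε_blk_eq_zero fun k _ _ => by rw [ε_col, if_neg (by omega)]

theorem φ_blk_col {i : ℕ} (hi : 1 ≤ i) (a : ℕ → ℕ) (m : ℕ) :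
    φ i (blk (col 1) a m) = if i ≤ m then a i else 0 := by
  have hrep : ∀ k r, φ i (List.replicate r (col 1 k)).flatten = if i = k then r else 0 := by
    intro k r
    induction r with
    | zero => simp [φ]
    | succ r ih =>
      rw [List.replicate_succ, List.flatten_cons, φ_append, ih, φ_col, ε_col]
      split_ifs <;> omega
  induction m with
  | zero => simp [blk, φ, show i ≠ 0 by omega]
  | succ m ih =>
    rw [blk, φ_append, hrep, ih, ε_flatten_replicate_eq_zero (by rw [ε_col, if_neg (by omega)])]
    rcases lt_trichotomy i (m + 1) with h | rfl | h
    · simp [show i ≠ m + 1 by omega, show i ≤ m by omega, show i ≤ m + 1 by omega]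
    · simp
    · simp [show i ≠ m + 1 by omega, show ¬ i ≤ m by omega, show ¬ i ≤ m + 1 by omega]

theorem sum_range_ite_lt {n m : ℕ} (hm : m < n) (g : ℕ → ℕ) :
    ∑ k ∈ Finset.range n, (if k ≤ m then g k else 0) = ∑ k ∈ Finset.range (m + 1), g k := by
  rw [← Finset.sum_filter]
  congr 1
  ext k
  simp only [Finset.mem_filter, Finset.mem_range]
  omega

/-- The staircase string `stair σ b n` and the string of the principal vertex `a` lead from some
common source with parameter `c` to words joined by a string with colors in `J`, the former word
being a source for `J`. -/
def Joins (n : ℕ) (c a : ℕ → ℕ) (σ b : ℕ → ℕ) (J : Set ℕ) : Prop :=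
  ∃ w x p T, (∀ i, 1 ≤ i → i ≤ n → φ i w = c i ∧ ε i w = 0) ∧
    run (stair σ b n) w = some x ∧ run (prinStr 0 n a) w = some p ∧ run T x = some p ∧
    (∀ i ∈ T, i ∈ J) ∧ ∀ i ∈ J, ε i x = 0

theorem prinStr_eq_blkStr (n : ℕ) (a : ℕ → ℕ) : prinStr 0 n a = blkStr (SStr 0 n) a n := by
  simp [prinStr, blkStr]

theorem joins_of_run {n : ℕ} {c a σ b : ℕ → ℕ} {J : Set ℕ} {X T : ℕ → List ℕ}
    (hac : ∀ k, 1 ≤ k → k ≤ n → a k ≤ c k) (hJ : ∀ i ∈ J, 1 ≤ i ∧ i ≤ n)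
    (hstair : ∀ q, (∀ i, 1 ≤ i → ε i q = 0) →
      run (stair σ b n) (q ++ blk (col 1) a n) = some (q ++ blk X a n))
    (hT : ∀ k, 1 ≤ k → k ≤ n → run (T k) (X k) = some (col (n - k + 2) k))
    (hTJ : ∀ k, 1 ≤ k → k ≤ n → ∀ i ∈ T k, i ∈ J)
    (hX : ∀ k, 1 ≤ k → k ≤ n → ∀ i ∈ J, ε i (X k) = 0) : Joins n c a σ b J := by
  have hq : ∀ i, 1 ≤ i → ε i (blk (col 1) (fun k => c k - a k) n) = 0 :=
    fun i hi => ε_blk_col hi _ _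
  have hend : ∀ k, 1 ≤ k → k ≤ n → ∀ i, i ≤ n → φ i (col (n - k + 2) k) = 0 := by
    intro k h1 h2 i hi
    rw [φ_col, if_neg (by omega)]
  rw [Joins, prinStr_eq_blkStr]
  refine ⟨blk (col 1) (fun k => c k - a k) n ++ blk (col 1) a n, _, _, blkStr T a n, ?_,
    hstair _ hq, run_blkStr (T := SStr 0 n) (I := Set.Icc 1 n) (Y := fun k => col (n - k + 2) k)
      ?_ ?_ ?_ ?_ ?_, run_blkStr hTJ hT hX ?_ ?_, ?_, ?_⟩
  · intro i h1 h2
    rw [φ_append, ε_append, hq i h1, ε_blk_col h1, φ_blk_col h1, φ_blk_col h1, if_pos h2, if_pos h2]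
    have := hac i h1 h2
    omega
  · intro k h1 h2 i hi
    have := mem_flatMap_wStr (j := 1) hi
    simp only [Set.mem_Icc]
    omega
  · intro k h1 h2
    rw [show n - k + 2 = 1 + (n - k + 1) by omega]
    exact run_flatMap_wStr k 1 (n - k + 1)
  · intro k _ _ i hi
    have := hi.1
    rw [ε_col, if_neg (by omega)]
  · intro k h1 h2 i hi
    exact hend k h1 h2 i hi.2
  · intro i hi
    exact hq i hi.1
  · intro k h1 h2 i hi
    exact hend k h1 h2 i (hJ i hi).2
  · intro i hi
    exact hq i (hJ i hi).1
  · intro i hi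
    obtain ⟨k, h1, h2, hi⟩ := mem_blkStr hi
    exact hTJ k h1 h2 i hi
  · intro i hi
    exact ε_append_eq_zero (hq i (hJ i hi).1) (ε_blk_eq_zero fun k h1 h2 => hX k h1 h2 i hi)

theorem joins_upper {n : ℕ} {c a : ℕ → ℕ} (hac : ∀ k, 1 ≤ k → k ≤ n → a k ≤ c k) :
    Joins n c a (fun k => k) a (Set.Icc 1 (n - 1)) := by
  let X : ℕ → ℕ → List ℕ := fun m k => if k ≤ m then (m + 1) :: col 1 (k - 1) else col 1 k
  have hX0 : blk (X 0) a n = blk (col 1) a n :=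
    blk_congr fun k h1 _ => by simp [X, show k ≠ 0 by omega]
  have hXn : ∀ k, k ≤ n → X n k = (n + 1) :: col 1 (k - 1) := fun k h => by simp [X, h]
  refine joins_of_run (X := X n) (T := fun k => SStr 0 (n - 1) (k - 1)) hac ?_ ?_ ?_ ?_ ?_
  · intro i hi
    simp only [Set.mem_Icc] at hi
    omega
  · intro q hq
    rw [← hX0]
    refine run_stair (P := fun m k => k ≤ m + 1) ?_ ?_ ?_ ?_ hq (fun m _ => by omega) ?_ le_rfl
    · intro m k hm h1 h2 h3
      have h4 : X m k = (m + 1) :: col 1 (k - 1) := by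
        by_cases h : k ≤ m
        · simp [X, h]
        · obtain rfl : k = m + 1 := by omega
          simp [X, col, add_comm]
      have h5 : X (m + 1) k = (m + 2) :: col 1 (k - 1) := by simp [X, h3]
      rw [h4, h5, F, if_pos ⟨rfl, by rw [φ_col, if_neg (by omega)]⟩]
    · intro m k hm h1 h2 h3
      simp [X, h3, show ¬ k ≤ m by omega]
    · intro m k hm h1 h2
      simp only [X]
      split_ifs
      · simp [ε, ε_col]
      · rw [ε_col, if_neg (by omega)]
    · intro m k hm h1 h2
      simp only [X]
      split_ifs
      · simp [φ, φ_col, show m + 1 + 1 ≠ 1 + (k - 1) by omega]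
      · rw [φ_col, if_neg (by omega)]
    · intro m hm
      simpa using sum_range_ite_lt hm fun k => a (k + 1)
  · intro k h1 h2
    have h3 := run_flatMap_wStr (k - 1) 1 (n - 1 - (k - 1) + 1)
    have h4 : ∀ i ∈ SStr 0 (n - 1) (k - 1), n + 1 ≠ i + 1 := by
      intro i hi
      have := mem_flatMap_wStr (j := 1) hi
      omega
    rw [hXn k h2, run_cons h4 h3]
    obtain ⟨k, rfl⟩ : ∃ l, k = l + 1 := ⟨k - 1, by omega⟩
    rw [col, Nat.add_sub_cancel, show 1 + (n - 1 - k + 1) = n - (k + 1) + 2 by omega,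
      show n - (k + 1) + 2 + k = n + 1 by omega]
  · intro k h1 h2 i hi
    have := mem_flatMap_wStr (j := 1) hi
    simp only [Set.mem_Icc]
    omega
  · intro k h1 h2 i hi
    simp only [Set.mem_Icc] at hi
    rw [hXn k h2, ε, ε_col, if_neg (by omega), if_neg (by omega)]
    omega

theorem joins_lower {n : ℕ} {c a : ℕ → ℕ} (hac : ∀ k, 1 ≤ k → k ≤ n → a k ≤ c k) :
    Joins n c a (fun k => n + 1 - k) (fun k => a (n + 1 - k)) (Set.Icc 2 n) := by
  let X : ℕ → ℕ → List ℕ := fun m k =>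
    if n ≤ k + m then col (n - m + 2) (k + m - n) ++ col 1 (n - m) else col 1 k
  have hX0 : blk (X 0) a n = blk (col 1) a n := by
    refine blk_congr fun k _ h2 => ?_
    by_cases h : n ≤ k
    · obtain rfl : k = n := by omega
      simp [X, col]
    · simp [X, h]
  have hXn : ∀ k, X n k = col 2 k := fun k => by simp [X, col]
  refine joins_of_run (X := X n)
    (T := fun k => (List.range (n - k)).flatMap fun m => wStr 0 k (m + 2)) hac ?_ ?_ ?_ ?_ ?_
  · intro i hi
    simp only [Set.mem_Icc] at hi
    omega
  · intro q hq
    rw [← hX0]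
    refine run_stair (P := fun m k => n ≤ k + m) ?_ ?_ ?_ ?_ hq (fun m _ => by omega) ?_ le_rfl
    · intro m k hm h1 h2 h3
      obtain ⟨i, hi⟩ : ∃ i, n = m + (i + 1) := ⟨n - m - 1, by omega⟩
      have h4 : X m k = col (i + 3) (k + m - n) ++ (i + 1) :: col 1 i := by
        simp only [X, if_pos h3]
        rw [show n - m = i + 1 by omega, col, add_comm 1 i]
      have h5 : X (m + 1) k = col (i + 3) (k + m - n) ++ (i + 2) :: col 1 i := by
        simp only [X, if_pos (show n ≤ k + (m + 1) by omega)]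
        rw [show n - (m + 1) = i by omega, show k + (m + 1) - n = k + m - n + 1 by omega,
          ← col_succ_append, List.append_assoc]
        rfl
      rw [h4, h5, show n + 1 - (m + 1) = i + 1 by omega]
      refine F_append_right (by rw [ε_col, if_neg (by omega)]) ?_
      rw [F, if_pos ⟨rfl, by rw [φ_col, if_neg (by omega)]⟩]
    · intro m k hm h1 h2 h3
      simp only [X, if_neg h3]
      split_ifs with h
      · rw [show k + (m + 1) - n = 0 by omega, col, List.nil_append]
        congr 1
        omega
      · rfl
    · intro m k hm h1 h2
      simp only [X]
      split_ifs
      · refine ε_append_eq_zero ?_ ?_ <;> rw [ε_col, if_neg (by omega)]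
      · rw [ε_col, if_neg (by omega)]
    · intro m k hm h1 h2
      simp only [X]
      split_ifs
      · refine φ_append_eq_zero ?_ ?_ <;> rw [φ_col, if_neg (by omega)]
      · rw [φ_col, if_neg (by omega)]
    · intro m hm
      rw [← Finset.sum_range_reflect, ← sum_range_ite_lt hm]
      refine Finset.sum_congr rfl fun k hk => ?_
      rw [Finset.mem_range] at hk
      rw [show n - 1 - k + 1 = n + 1 - (k + 1) by omega]
      exact if_congr (by omega) rfl rfl
  · intro k h1 h2
    rw [hXn, run_flatMap_wStr]
    congr 2
    omega
  · intro k h1 h2 i hi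
    have := mem_flatMap_wStr hi
    simp only [Set.mem_Icc]
    omega
  · intro k h1 h2 i hi
    simp only [Set.mem_Icc] at hi
    rw [hXn, ε_col, if_neg (by omega)]

end Word

open ColorOps (Sync Matched Enumerates stair stair_congr exists_stair stair_injective mem_stair)

theorem ColorOps.LocalAx.mono {V : Type} {C : ColorOps V} {I J : Set ℕ} (h : C.LocalAx I)
    (hJ : J ⊆ I) : C.LocalAx J :=
  ⟨fun i hi j hj => h.1 i (hJ hi) j (hJ hj), fun i hi j hj => h.2 i (hJ hi) j (hJ hj)⟩

theorem Word.run_eq_map {V : Type} {C : ColorOps V} {f : V → List ℕ}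
    (hf : ∀ i v, Word.F i (f v) = (C.F i v).map f) (L : List ℕ) (v : V) :
    Word.run L (f v) = (C.run L v).map f := by
  induction L generalizing v with
  | nil => rfl
  | cons i L ih =>
    rw [Word.run, ColorOps.run, hf]
    cases C.F i v with
    | none => rfl
    | some u => exact ih u

theorem prinStr_congr {n : ℕ} {a a' : ℕ → ℕ} (h : ∀ k, 1 ≤ k → k ≤ n → a k = a' k) :
    prinStr 0 n a = prinStr 0 n a' := by
  unfold prinStr
  simp only [List.flatMap]
  congr 1
  refine List.map_congr_left fun k hk => ?_
  rw [List.mem_range] at hk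
  rw [h _ (by omega) (by omega)]

theorem mem_prinStr {n i : ℕ} {a : ℕ → ℕ} (h : i ∈ prinStr 0 n a) : i ∈ Set.Icc 1 n := by
  rw [Word.prinStr_eq_blkStr] at h
  obtain ⟨k, h1, h2, h⟩ := Word.mem_blkStr h
  have := Word.mem_flatMap_wStr (j := 1) h
  simp only [Set.mem_Icc]
  omega

section Component

variable {K : PreGraph} {J : Set ℕ} {u v w : K.V}

theorem inComp_symm (h : inComp K J u v) : inComp K J v u := by
  induction h with
  | refl => exact .refl
  | tail _ hstep ih =>
    obtain ⟨i, hi, hstep⟩ := hstep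
    exact .head ⟨i, hi, hstep.symm⟩ ih

theorem inComp_trans (h : inComp K J u v) (h' : inComp K J v w) : inComp K J u w :=
  Relation.ReflTransGen.trans h h'

theorem inComp_of_applyStr {L : List ℕ} (hL : ∀ i ∈ L, i ∈ J) (h : applyStr K L u = some v) :
    inComp K J u v := by
  induction L generalizing u with
  | nil => exact Option.some_injective _ h ▸ .refl
  | cons i L ih =>
    obtain ⟨w, hw, h⟩ := Option.bind_eq_some_iff.1 h
    exact .head ⟨i, hL i (by simp), .inl hw⟩ (ih (fun j hj => hL j (by simp [hj])) h)

/-- If a set meets each component exactly once, it is in bijection with the components. -/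
theorem bijOn_inComp {S : Set K.V} (h : ∀ u, ∃! p, p ∈ S ∧ inComp K J u p) :
    Set.BijOn (fun p => {w | inComp K J p w}) S {W | ∃ u, W = {w | inComp K J u w}} := by
  refine ⟨fun p _ => ⟨p, rfl⟩, fun p hp q hq he => ?_, ?_⟩
  · have hpq : inComp K J p q := (Set.ext_iff.1 he q).2 .refl
    exact (h p).unique ⟨hp, .refl⟩ ⟨hq, hpq⟩
  · rintro W ⟨u, rfl⟩
    obtain ⟨p, ⟨hp, hup⟩, -⟩ := h u
    exact ⟨p, hp, Set.ext fun w =>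
      ⟨fun hw => inComp_trans hup hw, fun hw => inComp_trans (inComp_symm hup) hw⟩⟩

variable {I : Set ℕ}

theorem exists_sync_of_inComp (hK : IsColored K I) {x : K.V}
    (M : Matched (K.ops hK) (K.ops hK) J x x) (h : inComp K J x u) :
    ∃ r u', Sync (K.ops hK) (K.ops hK) J x x r u u' := by
  induction h with
  | refl => exact ⟨0, x, .base⟩
  | tail _ hstep ih =>
    obtain ⟨r, u', hu'⟩ := ih
    obtain ⟨i, hi, hv | hv⟩ := hstep
    · obtain ⟨v', -, hv'⟩ := hu'.succ M hi hv
      exact ⟨_, v', hv'⟩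
    · obtain ⟨v', r', -, -, hv'⟩ := hu'.pred M hi hv
      exact ⟨_, v', hv'⟩

theorem matched_self (hK : IsCrystalOn K I) (hJ : J ⊆ I) {x : K.V} (hx : ∀ i ∈ J, K.t i x = 0) :
    Matched (K.ops hK.1) (K.ops hK.1) J x x :=
  ⟨(PreGraph.localAx_ops hK).mono hJ, (PreGraph.localAx_ops hK).mono hJ, hx, hx, fun _ _ => rfl⟩

theorem eq_of_inComp (hK : IsCrystalOn K I) (hJ : J ⊆ I) {x y : K.V}
    (hx : ∀ i ∈ J, K.t i x = 0) (hy : ∀ i ∈ J, K.t i y = 0) (h : inComp K J x y) : y = x := by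
  obtain ⟨r, u', hs⟩ := exists_sync_of_inComp hK.1 (matched_self hK hJ hx) h
  rcases hs with _ | ⟨_, hi, hv, _⟩
  · rfl
  · have := PreGraph.t_eq_add_one hK.1 hv
    have := hy _ hi
    omega

theorem t_eq_zero_of_isSource (hK : IsColored K I) {s : K.V} (hs : IsSource K s) (i : ℕ) :
    K.t i s = 0 := by
  by_contra h
  obtain ⟨u, hu⟩ := PreGraph.exists_pred_of_t_pos hK (Nat.pos_of_ne_zero h)
  exact hs i u hu

theorem inComp_of_isCrystalOn (hK : IsCrystalOn K I) (u v : K.V) : inComp K I u v := by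
  refine Relation.ReflTransGen.mono ?_ _ _ (hK.2.1 u v)
  rintro x y ⟨i, h⟩
  refine ⟨i, ?_, h⟩
  by_contra hi
  rcases h with h | h <;> simp [hK.1.2.1 i hi] at h

/-- Every component has a vertex without incoming edges in the component. -/
theorem exists_inComp_source (hK : IsCrystalOn K I) (hJ : J ⊆ I) {s : K.V} (hs : IsSource K s)
    (u : K.V) : ∃ x, inComp K J u x ∧ ∀ i ∈ J, K.t i x = 0 := by
  have M := matched_self hK subset_rfl fun i _ => t_eq_zero_of_isSource hK.1 hs i
  obtain ⟨r, u', h⟩ := exists_sync_of_inComp hK.1 M (inComp_of_isCrystalOn hK s u)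
  induction r generalizing u u' with
  | zero =>
    refine ⟨u, .refl, fun i hi => ?_⟩
    by_contra ht
    obtain ⟨v, hv⟩ := PreGraph.exists_pred_of_t_pos hK.1 (Nat.pos_of_ne_zero ht)
    obtain ⟨_, _, hr, -⟩ := h.pred M (hJ hi) hv
    omega
  | succ r ih =>
    by_cases hall : ∀ i ∈ J, K.t i u = 0
    · exact ⟨u, .refl, hall⟩
    · push Not at hall
      obtain ⟨i, hi, ht⟩ := hall
      obtain ⟨v, hv⟩ := PreGraph.exists_pred_of_t_pos hK.1 (Nat.pos_of_ne_zero ht)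
      obtain ⟨v', r', hr, -, hv'⟩ := h.pred M (hJ hi) hv
      obtain rfl : r = r' := by omega
      obtain ⟨x, hx, hx'⟩ := ih v v' hv'
      exact ⟨x, .head ⟨i, hi, .inr hv⟩ hx, hx'⟩

end Component

/-- The principal vertex `a` lies in the `J`-component whose source is reached by a staircase
string. -/
theorem exists_prin_of_joins {n : ℕ} {K : PreGraph} (hK : IsACrystal n K) {s : K.V}
    (hs : IsSource K s) {c : ℕ → ℕ} (hc : ∀ i, 1 ≤ i → i ≤ n → K.h i s = c i) {a σ b : ℕ → ℕ}
    {J : Set ℕ} (hJ : J ⊆ Set.Icc 1 n) (hσ : ∀ k, 1 ≤ k → k ≤ n → σ k ∈ Set.Icc 1 n)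
    (h : Word.Joins n c a σ b J) :
    ∃ x p, (K.ops hK.1).run (stair σ b n) s = some x ∧ IsPrin K 0 n s a p ∧ inComp K J x p ∧
      ∀ i ∈ J, K.t i x = 0 := by
  obtain ⟨w, x', p', T, hw, hx, hp, hT, hTJ, hxJ⟩ := h
  obtain ⟨V, C, f, b₀, hC, hf, rfl, hF, hφ, hε⟩ := Word.exists_model w
  rw [Word.run_eq_map hF] at hx hp
  obtain ⟨x', hx', rfl⟩ := Option.map_eq_some_iff.1 hx
  obtain ⟨p', hp', rfl⟩ := Option.map_eq_some_iff.1 hp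
  rw [Word.run_eq_map hF] at hT
  obtain ⟨p'', hT', hpp⟩ := Option.map_eq_some_iff.1 hT
  obtain rfl := hf hpp
  have M : Matched (K.ops hK.1) C (Set.Icc 1 n) s b₀ :=
    ⟨PreGraph.localAx_ops hK, hC.mono (Set.subset_univ _),
      fun i _ => t_eq_zero_of_isSource hK.1 hs i, fun i hi => by rw [← hε, (hw i hi.1 hi.2).2],
      fun i hi => by rw [← hφ, (hw i hi.1 hi.2).1]; exact hc i hi.1 hi.2⟩
  obtain ⟨x, r, hxK, hxs⟩ := Sync.run_right M (fun i hi => by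
    obtain ⟨k, h1, h2, rfl⟩ := mem_stair hi
    exact hσ k h1 h2) .base hx'
  obtain ⟨p, r', hpK, hps⟩ := Sync.run_right M (fun i hi => mem_prinStr hi) .base hp'
  obtain ⟨q, r'', hqK, hqs⟩ := hxs.run_right M (fun i hi => hJ (hTJ i hi)) hT'
  obtain rfl := hps.left_unique M hqs
  rw [PreGraph.ops_run] at hpK hqK
  refine ⟨x, p, hxK, hpK, inComp_of_applyStr hTJ hqK, fun i hi => ?_⟩
  have := hxs.ε_eq M (hJ hi)
  rw [← hε, hxJ i hi] at this
  exact this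

/-- Every component with color set `J`, obtained by removing the last color of an enumeration `σ`
of all colors along the Dynkin diagram, contains exactly one principal vertex. -/
theorem existsUnique_prin {n : ℕ} {K : PreGraph} (hK : IsACrystal n K) {s : K.V}
    (hs : IsSource K s) {c : ℕ → ℕ} (hc : ∀ i, 1 ≤ i → i ≤ n → K.h i s = c i) {σ : ℕ → ℕ}
    {J : Set ℕ} (hσ : Enumerates σ (Set.Icc 1 n) n)
    (hσσ : ∀ k, 1 ≤ k → k ≤ n → σ (σ k) = k) (hJ : ∀ i, i ∈ J ↔ ∃ k, 1 ≤ k ∧ k < n ∧ σ k = i)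
    (hjoin : ∀ a : ℕ → ℕ, (∀ k, 1 ≤ k → k ≤ n → a k ≤ c k) →
      Word.Joins n c a σ (fun k => a (σ k)) J) (u : K.V) :
    ∃! p, p ∈ PrinLat K n s c ∧ inComp K J u p := by
  have hmem : ∀ k, 1 ≤ k → k ≤ n → σ k ∈ Set.Icc 1 n := fun k => hσ.mem
  have hJI : J ⊆ Set.Icc 1 n := by
    intro i hi
    obtain ⟨k, h1, h2, rfl⟩ := (hJ i).1 hi
    exact hmem k h1 h2.le
  have hloc := PreGraph.localAx_ops hK
  have hsrc : ∀ u : K.V, (∀ k, 1 ≤ k → k ≤ n → K.t (σ k) u = 0) → u = s := by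
    intro v hv
    refine eq_of_inComp hK subset_rfl (fun i _ => t_eq_zero_of_isSource hK.1 hs i) ?_
      (inComp_of_isCrystalOn hK s v)
    intro i hi
    rw [← hσσ i hi.1 hi.2]
    exact hv _ (hmem i hi.1 hi.2).1 (hmem i hi.1 hi.2).2
  obtain ⟨x, hux, hx⟩ := exists_inComp_source hK hJI hs u
  obtain ⟨b, hb, hbx⟩ := exists_stair (C := K.ops hK.1) hσ hloc
    (fun i hi j hj hij => (hK.2.2.1 i hi j hj (by rintro rfl; unfold Neighb at hij; omega)).2)
    hsrc (u := x) fun k h1 h2 => hx _ ((hJ _).2 ⟨k, h1, h2, rfl⟩)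
  have hex : ∀ a : ℕ → ℕ, (∀ k, 1 ≤ k → k ≤ n → a k ≤ c k) →
      ∃ y p, (K.ops hK.1).run (stair σ (fun k => a (σ k)) n) s = some y ∧ IsPrin K 0 n s a p ∧
        inComp K J y p ∧ ∀ i ∈ J, K.t i y = 0 :=
    fun a ha => exists_prin_of_joins hK hs hc hJI hmem (hjoin a ha)
  have hac : ∀ k, 1 ≤ k → k ≤ n → b (σ k) ≤ c k := by
    intro k h1 h2
    have := hmem k h1 h2
    rw [← hc k h1 h2]
    have hle := hb (σ k) this.1 this.2
    rwa [hσσ k h1 h2] at hle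
  obtain ⟨y, p, hy, hp, hyp, -⟩ := hex (fun k => b (σ k)) hac
  rw [stair_congr (b' := b) fun k h1 h2 => by rw [hσσ k h1 h2], hbx] at hy
  obtain rfl := Option.some_injective _ hy
  refine ⟨p, ⟨⟨_, hac, hp⟩, inComp_trans hux hyp⟩, ?_⟩
  rintro p' ⟨⟨a', ha', hp'⟩, hup'⟩
  obtain ⟨y', q, hy', hq, hyq, hyJ⟩ := hex a' ha'
  obtain rfl : q = p' := Option.some_injective _ (hq.symm.trans hp')
  obtain rfl := eq_of_inComp hK hJI hx hyJ
    (inComp_trans (inComp_symm hux) (inComp_trans hup' (inComp_symm hyq)))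
  have hbb := stair_injective hσ hloc (fun k _ _ => t_eq_zero_of_isSource hK.1 hs _) le_rfl hy' hbx
  have haa : ∀ k, 1 ≤ k → k ≤ n → a' k = b (σ k) := by
    intro k h1 h2
    have := hmem k h1 h2
    rw [← hbb (σ k) this.1 this.2, hσσ k h1 h2]
  unfold IsPrin prinOpt at hp hq
  rw [prinStr_congr haa, hp] at hq
  exact (Option.some_injective _ hq).symm

theorem existsUnique_prin_upper {n : ℕ} {K : PreGraph} (hK : IsACrystal n K) {s : K.V}
    (hs : IsSource K s) {c : ℕ → ℕ} (hc : ∀ i, 1 ≤ i → i ≤ n → K.h i s = c i) (u : K.V) :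
    ∃! p, p ∈ PrinLat K n s c ∧ inComp K (Set.Icc 1 (n - 1)) u p := by
  refine existsUnique_prin hK hs hc (σ := fun k => k) ⟨fun h1 h2 => ⟨h1, h2⟩, ?_, ?_⟩
    (fun _ _ _ => rfl) ?_ (fun a ha => Word.joins_upper ha) u
  · intro k _ _
    exact .inl rfl
  · intro k l _ h _
    exact .inl h
  · intro i
    simp only [Set.mem_Icc]
    exact ⟨fun h => ⟨i, by omega, by omega, rfl⟩, fun ⟨k, h1, h2, h3⟩ => by omega⟩

theorem existsUnique_prin_lower {n : ℕ} {K : PreGraph} (hK : IsACrystal n K) {s : K.V}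
    (hs : IsSource K s) {c : ℕ → ℕ} (hc : ∀ i, 1 ≤ i → i ≤ n → K.h i s = c i) (u : K.V) :
    ∃! p, p ∈ PrinLat K n s c ∧ inComp K (Set.Icc 2 n) u p := by
  refine existsUnique_prin hK hs hc (σ := fun k => n + 1 - k) ⟨?_, ?_, ?_⟩
    (fun k _ _ => by omega) ?_ (fun a ha => Word.joins_lower ha) u
  · intro k _ _
    simp only [Set.mem_Icc]
    omega
  · intro k _ _
    unfold Neighb
    omega
  · intro k l _ _ _
    unfold Far
    omega
  · intro i
    simp only [Set.mem_Icc]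
    exact ⟨fun h => ⟨n + 1 - i, by omega, by omega, by omega⟩, fun ⟨k, h1, h2, h3⟩ => by omega⟩

/-- Every upper (lower) subcrystal of an `A_n`-crystal `K(c)` contains
exactly one principal vertex, and assigning to each upper (lower) subcrystal its unique
principal vertex is a bijection onto the principal lattice. -/
theorem subcrystals_biject_with_principal_lattice
    (n : ℕ) (K : PreGraph) (hK : IsACrystal n K)
    (s : K.V) (hs : IsSource K s)
    (c : ℕ → ℕ) (hc : ∀ i, 1 ≤ i → i ≤ n → K.h i s = c i) :
    (∀ u : K.V, ∃! p : K.V, p ∈ PrinLat K n s c ∧ inComp K (Set.Icc 1 (n - 1)) u p) ∧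
    Set.BijOn (fun p => {w | inComp K (Set.Icc 1 (n - 1)) p w}) (PrinLat K n s c)
      {W : Set K.V | ∃ u, W = {w | inComp K (Set.Icc 1 (n - 1)) u w}} ∧
    (∀ u : K.V, ∃! p : K.V, p ∈ PrinLat K n s c ∧ inComp K (Set.Icc 2 n) u p) ∧
    Set.BijOn (fun p => {w | inComp K (Set.Icc 2 n) p w}) (PrinLat K n s c)
      {W : Set K.V | ∃ u, W = {w | inComp K (Set.Icc 2 n) u w}} := by
  exact ⟨existsUnique_prin_upper hK hs hc, bijOn_inComp (existsUnique_prin_upper hK hs hc),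
    existsUnique_prin_lower hK hs hc, bijOn_inComp (existsUnique_prin_lower hK hs hc)⟩
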